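/- Let d ∈ ℕ, α > 0, and let (σ, A) be an α-Hölder continuous GL(d,ℝ)-cocycle over a transitive subshift of finite type σ: Σ_H → Σ_H with positive topological entropy. If h_top(σ|_{B(A,κ)}) = h_top(σ|_{Σ_H}) for some κ > 0, then (σ, A) is continuously conjugate to an isometric cocycle. -/

import Mathlib

open Filter Topology Matrix Pointwise

namespace Paper

variable {𝒜 : Type*} [Fintype 𝒜] [DecidableEq 𝒜]

/-- The space of bi-infinite sequences over the alphabet `𝒜`. -/
abbrev Seq (𝒜 : Type*) := ℤ → 𝒜

/-- The left shift map. -/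
def shift (x : Seq 𝒜) : Seq 𝒜 := fun i => x (i + 1)

/-- The inverse of the left shift map. -/
def shiftInv (x : Seq 𝒜) : Seq 𝒜 := fun i => x (i - 1)

/-- `n`-th power of the shift, `n : ℤ`. -/
def shiftZ (n : ℤ) (x : Seq 𝒜) : Seq 𝒜 := fun i => x (i + n)

/-- The subshift of finite type with transition rule `H`. -/
def SFT (H : 𝒜 → 𝒜 → Prop) : Set (Seq 𝒜) := {x | ∀ i : ℤ, H (x i) (x (i + 1))}

open Classical in
/-- dist(x,y) = 2^{-n}, n = min{|i| : x i ≠ y i}. -/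
noncomputable def seqDist (x y : Seq 𝒜) : ℝ :=
  if x = y then 0
  else (2 : ℝ) ^ (-((sInf {n : ℕ | ∃ i : ℤ, i.natAbs = n ∧ x i ≠ y i} : ℕ) : ℤ))

/-- Transitivity: some point has dense forward orbit in `Σ_H`. -/
def IsTransitive (H : 𝒜 → 𝒜 → Prop) : Prop :=
  ∃ x ∈ SFT H, ∀ y ∈ SFT H, ∀ ε : ℝ, 0 < ε → ∃ n : ℕ, seqDist (shift^[n] x) y < ε

/-- The number of words of length `n` appearing in sequences of `X`. -/
noncomputable def wordCount (X : Set (Seq 𝒜)) (n : ℕ) : ℕ :=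
  Nat.card {w : Fin n → 𝒜 // ∃ x ∈ X, ∃ k : ℤ, ∀ i : Fin n, x (k + (i : ℤ)) = w i}

/-- Topological entropy of the shift restricted to `X`, via word counting. -/
noncomputable def entropy (X : Set (Seq 𝒜)) : ℝ :=
  Filter.atTop.limsup fun n : ℕ => Real.log (wordCount X n : ℝ) / (n : ℝ)

/-- The Euclidean norm on `ℝ^d`. -/
noncomputable def eNorm {d : ℕ} (u : Fin d → ℝ) : ℝ := Real.sqrt (∑ i, (u i) ^ 2)

/-- The operator norm of a matrix, induced by the Euclidean norm. -/
noncomputable def opNorm {d : ℕ} (M : Matrix (Fin d) (Fin d) ℝ) : ℝ :=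
  sSup {r : ℝ | ∃ u : Fin d → ℝ, eNorm u = 1 ∧ r = eNorm (M.mulVec u)}

/-- Forward iterates of a cocycle over the shift: `A_0 = 1`, `A_{n+1}(x) = A_n(σ x) * A x`. -/
def iterN {M : Type*} [Monoid M] (A : Seq 𝒜 → M) : ℕ → Seq 𝒜 → M
  | 0, _ => 1
  | n + 1, x => iterN A n (shift x) * A x

/-- Iterates of a cocycle over the shift, indexed by `ℤ`. -/
noncomputable def iterZ {Gr : Type*} [Group Gr] (A : Seq 𝒜 → Gr) (n : ℤ) (x : Seq 𝒜) : Gr :=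
  if 0 ≤ n then iterN A n.toNat x
  else (iterN A (-n).toNat (shiftInv^[(-n).toNat] x))⁻¹

variable {d : ℕ}

/-- Underlying matrix of an element of `GL(d,ℝ)`. -/
def glMat (g : GL (Fin d) ℝ) : Matrix (Fin d) (Fin d) ℝ := g.val

/-- `B(A,κ)`: points of `Σ_H` whose full orbit is fiberwise bounded by `κ`. -/
noncomputable def BSet (H : 𝒜 → 𝒜 → Prop) (A : Seq 𝒜 → GL (Fin d) ℝ) (κ : ℝ) :
    Set (Seq 𝒜) :=
  {x ∈ SFT H | ∀ n : ℤ, opNorm (glMat (iterZ A n x)) ≤ κ ∧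
    opNorm (glMat (iterZ A n x)⁻¹) ≤ κ}

/-- The `C⁰` distance between two cocycles over `Σ_H`. -/
noncomputable def dC0 (H : 𝒜 → 𝒜 → Prop) (A B : Seq 𝒜 → GL (Fin d) ℝ) : ℝ :=
  sSup {r : ℝ | ∃ x ∈ SFT H, r = opNorm (glMat (A x) - glMat (B x))}

/-- The `C^α` Hölder seminorm of a matrix-valued map on `Σ_H`. -/
noncomputable def holderSemi (H : 𝒜 → 𝒜 → Prop) (f : Seq 𝒜 → Matrix (Fin d) (Fin d) ℝ)
    (α : ℝ) : ℝ :=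
  sSup {r : ℝ | ∃ x ∈ SFT H, ∃ y ∈ SFT H, x ≠ y ∧ r = opNorm (f x - f y) / seqDist x y ^ α}

/-- A cocycle is `α`-Hölder if its `C^α` seminorm is finite. -/
def IsHolder (H : 𝒜 → 𝒜 → Prop) (A : Seq 𝒜 → GL (Fin d) ℝ) (α : ℝ) : Prop :=
  ∃ C : ℝ, ∀ x ∈ SFT H, ∀ y ∈ SFT H,
    opNorm (glMat (A x) - glMat (A y)) ≤ C * seqDist x y ^ α

/-- The `C^α` distance between two cocycles over `Σ_H`. -/
noncomputable def dCalpha (H : 𝒜 → 𝒜 → Prop) (A B : Seq 𝒜 → GL (Fin d) ℝ) (α : ℝ) : ℝ :=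
  dC0 H A B + holderSemi H (fun x => glMat (A x) - glMat (B x)) α

/-- Continuity (with respect to `seqDist`) of a matrix-valued map on `Σ_H`. -/
def MatContinuousOn (H : 𝒜 → 𝒜 → Prop) (f : Seq 𝒜 → Matrix (Fin d) (Fin d) ℝ) : Prop :=
  ∀ x ∈ SFT H, ∀ ε : ℝ, 0 < ε → ∃ δ : ℝ, 0 < δ ∧
    ∀ y ∈ SFT H, seqDist x y < δ → opNorm (f x - f y) < ε

/-- `(σ, A)` is continuously conjugate to an isometric cocycle. -/
def ConjIsometric (H : 𝒜 → 𝒜 → Prop) (A : Seq 𝒜 → GL (Fin d) ℝ) : Prop :=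
  ∃ P : Seq 𝒜 → GL (Fin d) ℝ, MatContinuousOn H (fun x => glMat (P x)) ∧
    ∀ x ∈ SFT H, glMat ((P (shift x))⁻¹ * A x * P x) ∈ Matrix.orthogonalGroup (Fin d) ℝ

/-- `(σ, A)` admits a dominated splitting: a continuous invariant splitting
`ℝ^d = E₁ ⊕ E₂` (encoded by a continuous field of nontrivial idempotents `π` with
`E₁ = range π`, `E₂ = ker π`) with uniformly separated growth rates. -/
def HasDominatedSplitting (H : 𝒜 → 𝒜 → Prop) (A : Seq 𝒜 → GL (Fin d) ℝ) : Prop :=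
  ∃ π : Seq 𝒜 → Matrix (Fin d) (Fin d) ℝ,
    MatContinuousOn H π ∧
    (∀ x ∈ SFT H, π x * π x = π x ∧ π x ≠ 0 ∧ π x ≠ 1) ∧
    (∀ x ∈ SFT H, glMat (A x) * π x = π (shift x) * glMat (A x)) ∧
    ∃ C : ℝ, 0 < C ∧ ∃ lam : ℝ, 0 < lam ∧ lam < 1 ∧
      ∀ x ∈ SFT H, ∀ n : ℕ, 1 ≤ n →
        ∀ u ∈ LinearMap.range (π x).mulVecLin, ∀ v ∈ LinearMap.ker (π x).mulVecLin,
          eNorm ((glMat (iterN A n x)).mulVec u) * eNorm v ≤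
            C * lam ^ n * (eNorm u * eNorm ((glMat (iterN A n x)).mulVec v))

/-- `H`-admissible finite words. -/
def Adm (H : 𝒜 → 𝒜 → Prop) (w : List 𝒜) : Prop := w.Chain' H

/-- The word `(x_{-k}, …, x_k)` read in the sequence `x`. -/
def window (k : ℕ) (x : Seq 𝒜) : List 𝒜 :=
  (List.range (2 * k + 1)).map fun i => x ((i : ℤ) - (k : ℤ))

/-- `w` is a transition from `a` to `b`: an admissible word with prefix `a` and suffix `b`. -/
def IsTransition (H : 𝒜 → 𝒜 → Prop) (a b w : List 𝒜) : Prop :=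
  Adm H w ∧ a <+: w ∧ b <:+ w

/-- The product `A_[w⟩ = φ(w⁽ⁿ⁻²ᵏ⁾) ⋯ φ(w⁽¹⁾)` of a locally constant cocycle
represented by `φ` along the walk `w`. -/
def transProd {M : Type*} [Monoid M] (φ : List 𝒜 → M) (k : ℕ) (w : List 𝒜) : M :=
  (((List.range (w.length - 2 * k)).map fun i => φ ((w.drop i).take (2 * k + 1))).reverse).prod

section SubgroupCocycle

variable {G : Subgroup (GL (Fin d) ℝ)}

/-- Underlying matrix of an element of the subgroup `G ⊂ GL(d,ℝ)`. -/
def subMat (g : ↥G) : Matrix (Fin d) (Fin d) ℝ := ((g : GL (Fin d) ℝ) : Matrix (Fin d) (Fin d) ℝ)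

/-- `B(A,κ)` for `G`-valued cocycles. -/
noncomputable def BSetSub (H : 𝒜 → 𝒜 → Prop) (A : Seq 𝒜 → ↥G) (κ : ℝ) : Set (Seq 𝒜) :=
  {x ∈ SFT H | ∀ n : ℤ, opNorm (subMat (iterZ A n x)) ≤ κ ∧
    opNorm (subMat (iterZ A n x)⁻¹) ≤ κ}

/-- `C⁰` distance for `G`-valued cocycles. -/
noncomputable def dC0Sub (H : 𝒜 → 𝒜 → Prop) (A B : Seq 𝒜 → ↥G) : ℝ :=
  sSup {r : ℝ | ∃ x ∈ SFT H, r = opNorm (subMat (A x) - subMat (B x))}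

/-- `α`-Hölder condition for `G`-valued cocycles. -/
def IsHolderSub (H : 𝒜 → 𝒜 → Prop) (A : Seq 𝒜 → ↥G) (α : ℝ) : Prop :=
  ∃ C : ℝ, ∀ x ∈ SFT H, ∀ y ∈ SFT H,
    opNorm (subMat (A x) - subMat (A y)) ≤ C * seqDist x y ^ α

/-- `C^α` distance for `G`-valued cocycles. -/
noncomputable def dCalphaSub (H : 𝒜 → 𝒜 → Prop) (A B : Seq 𝒜 → ↥G) (α : ℝ) : ℝ :=
  dC0Sub H A B + holderSemi H (fun x => subMat (A x) - subMat (B x)) α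

/-- The covering condition for a locally constant `G`-cocycle represented by `φ`
(depending on positions in `⟦-k, k⟧`). -/
def CoveringCond (H : 𝒜 → 𝒜 → Prop) (φ : List 𝒜 → ↥G) (k : ℕ) : Prop :=
  ∃ U : Set ↥G, U.Nonempty ∧ IsOpen U ∧ IsCompact (closure U) ∧
    ∃ A' : Set (List 𝒜), A'.Nonempty ∧ (∀ a ∈ A', Adm H a ∧ a.length = 2 * k + 1) ∧
      ∀ a ∈ A', closure U ⊆
        ⋃ b ∈ A', ⋃ w ∈ {w : List 𝒜 | IsTransition H a b w}, (fun u => (transProd φ k w)⁻¹ * u) '' U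

/-- `w₁` is a proper prefix of `w₂`. -/
def ProperPrefix (w₁ w₂ : List 𝒜) : Prop := w₁ <+: w₂ ∧ w₁ ≠ w₂

/-- The multiple covering condition of `m` layers for a locally constant `G`-cocycle
represented by `φ` (depending on positions in `⟦-k, k⟧`). -/
def MultiCoveringCond (H : 𝒜 → 𝒜 → Prop) (φ : List 𝒜 → ↥G) (k : ℕ) (m : ℕ) : Prop :=
  ∃ n : ℕ, 0 < n ∧ ∃ U : Fin n → Set ↥G,
    (∀ ι, (U ι).Nonempty ∧ IsOpen (U ι) ∧ IsCompact (closure (U ι))) ∧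
    ∃ A' : Set (List 𝒜), A'.Nonempty ∧ (∀ a ∈ A', Adm H a ∧ a.length = 2 * k + 1) ∧
      ∃ Λ : List 𝒜 → Fin n → Fin m → Set (List 𝒜),
        (∀ a ∈ A', ∀ ι jj, (Λ a ι jj).Nonempty ∧
          Λ a ι jj ⊆ {w : List 𝒜 | ∃ b ∈ A', IsTransition H a b w}) ∧
        (∀ a ∈ A', ∀ ι : Fin n, ∀ j₁ j₂ : Fin m, ∀ w₁ ∈ Λ a ι j₁, ∀ w₂ ∈ Λ a ι j₂,
          ¬ ProperPrefix w₁ w₂) ∧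
        (∀ a ∈ A', ∀ ι jj, closure (U ι) ⊆
          ⋃ w ∈ Λ a ι jj, (fun u => (transProd φ k w)⁻¹ * u) '' (⋃ ι', U ι'))

/-- The ball of radius `r` around the identity in `G`. -/
noncomputable def GBall (G : Subgroup (GL (Fin d) ℝ)) (r : ℝ) : Set ↥G :=
  {g : ↥G | opNorm (subMat g - 1) < r}

end SubgroupCocycle

/-- `P_[w] = g_k ⋯ g_1` for `w = (g_1, …, g_k)`. -/
def prodMap {M : Type*} [Monoid M] {k : ℕ} (w : Fin k → M) : M :=
  ((List.ofFn w).reverse).prod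

/-- The local unstable set of `y` in `Σ_H`. -/
def WuLoc (H : 𝒜 → 𝒜 → Prop) (y : Seq 𝒜) : Set (Seq 𝒜) :=
  {z ∈ SFT H | ∀ i : ℤ, i ≤ 0 → z i = y i}


/-! ### Basic symbolic dynamics -/

/-- Agreement on the window `[-m, m]`. -/
def agree {𝒜 : Type*} (m : ℕ) (x y : Seq 𝒜) : Prop := ∀ i : ℤ, |i| ≤ (m : ℤ) → x i = y i

theorem shift_iter {𝒜 : Type*} (n : ℕ) (x : Seq 𝒜) (i : ℤ) : (shift^[n] x) i = x (i + n) := by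
  induction n generalizing x i with
  | zero => simp
  | succ n ih =>
    rw [Function.iterate_succ_apply, ih]
    simp only [shift]
    congr 1
    push_cast
    ring

theorem shift_mem {𝒜 : Type*} {H : 𝒜 → 𝒜 → Prop} {x : Seq 𝒜} (hx : x ∈ SFT H) :
    shift x ∈ SFT H := fun i => hx (i + 1)

theorem shift_iter_mem {𝒜 : Type*} {H : 𝒜 → 𝒜 → Prop} {x : Seq 𝒜} (hx : x ∈ SFT H) (n : ℕ) :
    shift^[n] x ∈ SFT H := by
  intro i
  rw [shift_iter, shift_iter]
  have := hx (i + n)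
  rwa [show i + 1 + (n : ℤ) = i + n + 1 by ring]

theorem shiftZ_mem {𝒜 : Type*} {H : 𝒜 → 𝒜 → Prop} {x : Seq 𝒜} (hx : x ∈ SFT H) (n : ℤ) :
    shiftZ n x ∈ SFT H := by
  intro i
  simp only [shiftZ]
  have := hx (i + n)
  rwa [show i + 1 + (n : ℤ) = i + n + 1 by ring]

theorem agree_of_dist {𝒜 : Type*} {m : ℕ} {x y : Seq 𝒜}
    (h : seqDist x y < (2 : ℝ) ^ (-(m : ℤ))) : agree m x y := by
  intro i hi
  by_contra hne
  have hxy : x ≠ y := fun h => hne (by rw [h])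
  rw [seqDist, if_neg hxy] at h
  have h1 := (zpow_lt_zpow_iff_right₀ (by norm_num : (1 : ℝ) < 2)).1 h
  have h2 : sInf {n : ℕ | ∃ i : ℤ, i.natAbs = n ∧ x i ≠ y i} ≤ i.natAbs :=
    Nat.sInf_le ⟨i, rfl, hne⟩
  rw [Int.abs_eq_natAbs] at hi
  omega

theorem dist_of_agree {𝒜 : Type*} {m : ℕ} {x y : Seq 𝒜}
    (h : agree m x y) : seqDist x y ≤ (2 : ℝ) ^ (-(m : ℤ)) := by
  by_cases hxy : x = y
  · rw [seqDist, if_pos hxy]; positivity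
  · rw [seqDist, if_neg hxy]
    apply zpow_le_zpow_right₀ (by norm_num)
    have hne : {n : ℕ | ∃ i : ℤ, i.natAbs = n ∧ x i ≠ y i}.Nonempty := by
      obtain ⟨i, hi⟩ := Function.ne_iff.1 hxy
      exact ⟨_, i, rfl, hi⟩
    obtain ⟨i, hi, hi2⟩ := Nat.sInf_mem hne
    rw [← hi]
    by_contra hlt
    exact hi2 (h i (by rw [Int.abs_eq_natAbs]; omega))

theorem dist_nonneg' {𝒜 : Type*} (x y : Seq 𝒜) : 0 ≤ seqDist x y := by
  rw [seqDist]; split_ifs <;> positivity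

theorem trans_dense {𝒜 : Type*} {H : 𝒜 → 𝒜 → Prop} (h : IsTransitive H) :
    ∃ x ∈ SFT H, ∀ y ∈ SFT H, ∀ m N : ℕ, ∃ n : ℕ, N ≤ n ∧
      ∀ i : ℤ, |i| ≤ (m : ℤ) → x (i + n) = y i := by
  obtain ⟨x, hx, hd⟩ := h
  have hd' : ∀ y ∈ SFT H, ∀ m : ℕ, ∃ n : ℕ, ∀ i : ℤ, |i| ≤ (m : ℤ) → x (i + n) = y i := by
    intro y hy m
    obtain ⟨n, hn⟩ := hd y hy ((2 : ℝ) ^ (-(m : ℤ))) (by positivity)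
    refine ⟨n, fun i hi => ?_⟩
    rw [← shift_iter n x i]
    exact agree_of_dist hn i hi
  refine ⟨x, hx, fun y hy m N => ?_⟩
  obtain ⟨b, hb⟩ := hd' y hy m
  obtain ⟨n, hn⟩ := hd' (shiftZ (-(N : ℤ)) x) (shiftZ_mem hx _) (m + b + N)
  refine ⟨n + N + b, by omega, fun i hi => ?_⟩
  rw [← hb i hi]
  have := hn (i + N + b) (by rw [abs_le] at *; push_cast; omega)
  simp only [shiftZ] at this
  rw [show i + ((n + N + b : ℕ) : ℤ) = i + N + b + n by push_cast; ring, this]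
  congr 1
  ring

/-- The word of length `n` read in `x` from position `k`. -/
def rd {𝒜 : Type*} (x : Seq 𝒜) (k : ℤ) (n : ℕ) : List 𝒜 :=
  (List.range n).map fun i : ℕ => x (k + i)

@[simp] theorem rd_length {𝒜 : Type*} (x : Seq 𝒜) (k : ℤ) (n : ℕ) : (rd x k n).length = n := by
  simp [rd]

theorem rd_add {𝒜 : Type*} (x : Seq 𝒜) (k : ℤ) (n m : ℕ) :
    rd x k (n + m) = rd x k n ++ rd x (k + n) m := by
  simp [rd, List.range_add, Function.comp_def, add_assoc]

theorem rd_succ {𝒜 : Type*} (x : Seq 𝒜) (k : ℤ) (n : ℕ) :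
    rd x k (n + 1) = x k :: rd x (k + 1) n := by
  rw [add_comm, rd_add]; simp [rd]

theorem rd_succ' {𝒜 : Type*} (x : Seq 𝒜) (k : ℤ) (n : ℕ) :
    rd x k (n + 1) = rd x k n ++ [x (k + n)] := by
  rw [rd_add]; simp [rd]

theorem rd_chain {𝒜 : Type*} {H : 𝒜 → 𝒜 → Prop} {x : Seq 𝒜} (hx : x ∈ SFT H) (k : ℤ) (n : ℕ) :
    (rd x k n).IsChain H := by
  induction n generalizing k with
  | zero => simp [rd]
  | succ n ih =>
    rw [rd_succ]
    cases n with
    | zero => simp [rd]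
    | succ n =>
      have := ih (k + 1)
      rw [rd_succ] at this ⊢
      exact List.isChain_cons_cons.2 ⟨hx k, this⟩

/-- Words of length `n` in `X`. -/
def Wd {𝒜 : Type*} (X : Set (Seq 𝒜)) (n : ℕ) : Set (List 𝒜) :=
  {l | ∃ x ∈ X, ∃ k : ℤ, l = rd x k n}

theorem Wd_finite {𝒜 : Type*} [Fintype 𝒜] (X : Set (Seq 𝒜)) (n : ℕ) : (Wd X n).Finite := by
  refine (List.finite_length_eq 𝒜 n).subset ?_
  rintro l ⟨x, -, k, rfl⟩
  simp

theorem wordCount_eq {𝒜 : Type*} [Fintype 𝒜] (X : Set (Seq 𝒜)) (n : ℕ) :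
    wordCount X n = (Wd X n).ncard := by
  rw [wordCount, ← Nat.card_coe_set_eq]
  have hrd : ∀ (x : Seq 𝒜) (k : ℤ), rd x k n = List.ofFn (fun i : Fin n => x (k + (i : ℤ))) := by
    intro x k
    apply List.ext_getElem <;> simp [rd]
  refine Nat.card_congr (Equiv.ofBijective
    (fun w => ⟨List.ofFn w.1, ?_⟩) ⟨?_, ?_⟩)
  · obtain ⟨w, x, hx, k, hk⟩ := w
    refine ⟨x, hx, k, ?_⟩
    rw [hrd]
    congr 1
    funext i
    exact (hk i).symm
  · rintro ⟨w, hw⟩ ⟨w', hw'⟩ h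
    simp only [Subtype.mk.injEq] at h ⊢
    exact List.ofFn_injective h
  · rintro ⟨l, x, hx, k, rfl⟩
    refine ⟨⟨fun i : Fin n => x (k + (i : ℤ)), x, hx, k, fun i => rfl⟩, ?_⟩
    simp [hrd]

theorem Wd_sub {𝒜 : Type*} [Fintype 𝒜] (X : Set (Seq 𝒜)) (n m : ℕ) :
    (Wd X (n + m)).ncard ≤ (Wd X n).ncard * (Wd X m).ncard := by
  rw [← Set.ncard_prod]
  refine Set.ncard_le_ncard_of_injOn (fun l => (l.take n, l.drop n)) ?_ ?_
    ((Wd_finite X n).prod (Wd_finite X m))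
  · rintro l ⟨x, hx, k, rfl⟩
    rw [rd_add]
    simp only [Set.mem_prod]
    rw [List.take_left' (by simp), List.drop_left' (by simp)]
    exact ⟨⟨x, hx, k, rfl⟩, ⟨x, hx, _, rfl⟩⟩
  · intro l _ l' _ h
    simp only [Prod.mk.injEq] at h
    rw [← List.take_append_drop n l, ← List.take_append_drop n l', h.1, h.2]

theorem Wd_le {𝒜 : Type*} [Fintype 𝒜] (X : Set (Seq 𝒜)) (n : ℕ) :
    (Wd X n).ncard ≤ (Fintype.card 𝒜) ^ n := by
  rw [← wordCount_eq, wordCount]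
  classical
  rw [Nat.card_eq_fintype_card]
  refine (Fintype.card_subtype_le _).trans ?_
  simp

theorem Wd_pos {𝒜 : Type*} [Fintype 𝒜] {X : Set (Seq 𝒜)} (hX : X.Nonempty) (n : ℕ) :
    0 < (Wd X n).ncard := by
  rw [Set.ncard_pos (Wd_finite X n)]
  obtain ⟨x, hx⟩ := hX
  exact ⟨_, x, hx, 0, rfl⟩

theorem log_Wd_bdd {𝒜 : Type*} [Fintype 𝒜] (X : Set (Seq 𝒜)) (n : ℕ) :
    Real.log (wordCount X n : ℝ) / n ≤ Real.log (Fintype.card 𝒜) := by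
  rw [wordCount_eq]
  have h0 : 0 ≤ Real.log (Fintype.card 𝒜 : ℝ) := Real.log_natCast_nonneg _
  rcases Nat.eq_zero_or_pos n with rfl | hn
  · simpa using h0
  rw [div_le_iff₀ (by positivity)]
  rcases Nat.eq_zero_or_pos (Wd X n).ncard with h | h
  · rw [h]; simp only [Nat.cast_zero, Real.log_zero]; positivity
  · rw [mul_comm, ← Real.log_pow]
    apply Real.log_le_log (by exact_mod_cast h)
    exact_mod_cast Wd_le X n

theorem entropy_empty {𝒜 : Type*} [Fintype 𝒜] : entropy (∅ : Set (Seq 𝒜)) = 0 := by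
  have : (fun n : ℕ => Real.log (wordCount (∅ : Set (Seq 𝒜)) n : ℝ) / (n : ℝ)) = fun _ => 0 := by
    funext n
    rw [wordCount_eq]
    have : Wd (∅ : Set (Seq 𝒜)) n = ∅ := by
      ext l; simp [Wd]
    simp [this]
  rw [entropy, this]
  simp

theorem entropy_lower {𝒜 : Type*} [Fintype 𝒜] {X : Set (Seq 𝒜)} (hX : X.Nonempty) (n : ℕ) :
    Real.exp (entropy X * n) ≤ (Wd X n).ncard := by
  have hpos : ∀ n, (0 : ℝ) < (Wd X n).ncard := fun n => by exact_mod_cast Wd_pos hX n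
  have hsub : Subadditive fun n : ℕ => Real.log (wordCount X n : ℝ) := by
    intro n m
    simp only [wordCount_eq]
    rw [← Real.log_mul (hpos n).ne' (hpos m).ne']
    apply Real.log_le_log (hpos _)
    exact_mod_cast Wd_sub X n m
  have hbdd : BddBelow (Set.range fun n : ℕ => Real.log (wordCount X n : ℝ) / n) := by
    refine ⟨0, ?_⟩
    rintro _ ⟨n, rfl⟩
    exact div_nonneg (Real.log_natCast_nonneg _) (by positivity)
  have hlim : entropy X = hsub.lim := (hsub.tendsto_lim hbdd).limsup_eq
  rw [hlim]
  rcases Nat.eq_zero_or_pos n with rfl | hn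
  · simp only [CharP.cast_eq_zero, mul_zero, Real.exp_zero]
    exact_mod_cast Wd_pos hX 0
  · have := hsub.lim_le_div hbdd hn.ne'
    rw [le_div_iff₀ (by positivity), wordCount_eq] at this
    rw [← Real.exp_log (hpos n)]
    exact Real.exp_le_exp.2 this

theorem entropy_upper {𝒜 : Type*} [Fintype 𝒜] {X : Set (Seq 𝒜)} (hX : X.Nonempty)
    {ε : ℝ} (hε : 0 < ε) :
    ∃ D : ℝ, 0 < D ∧ ∀ n : ℕ, ((Wd X n).ncard : ℝ) ≤ D * Real.exp ((entropy X + ε) * n) := by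
  have hpos : ∀ n, (0 : ℝ) < (Wd X n).ncard := fun n => by exact_mod_cast Wd_pos hX n
  have h1 : ∀ᶠ n : ℕ in atTop, Real.log (wordCount X n : ℝ) / n < entropy X + ε := by
    apply Filter.eventually_lt_of_limsup_lt
    · exact lt_add_of_pos_right _ hε
    · exact ⟨_, Filter.eventually_map.2 (Eventually.of_forall (log_Wd_bdd X))⟩
  obtain ⟨N, hN⟩ := eventually_atTop.1 h1
  refine ⟨1 + ∑ n ∈ Finset.range (N + 1),
    (Wd X n).ncard * Real.exp (-((entropy X + ε) * n)), by positivity, fun n => ?_⟩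
  by_cases hn : n ∈ Finset.range (N + 1)
  · have := Finset.single_le_sum (f := fun n : ℕ =>
      ((Wd X n).ncard : ℝ) * Real.exp (-((entropy X + ε) * n))) (fun i _ => by positivity) hn
    calc ((Wd X n).ncard : ℝ) = ((Wd X n).ncard * Real.exp (-((entropy X + ε) * n))) *
          Real.exp ((entropy X + ε) * n) := by
          rw [mul_assoc, ← Real.exp_add]; simp
      _ ≤ _ := by
          gcongr
          linarith
  · have hn' : N < n := by simpa using hn
    have := hN n hn'.le
    rw [div_lt_iff₀ (by norm_cast; omega), wordCount_eq] at this
    calc ((Wd X n).ncard : ℝ) = Real.exp (Real.log (Wd X n).ncard) := (Real.exp_log (hpos n)).symm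
      _ ≤ 1 * Real.exp ((entropy X + ε) * n) := by rw [one_mul]; exact Real.exp_le_exp.2 this.le
      _ ≤ _ := by
          gcongr
          have : 0 ≤ ∑ n ∈ Finset.range (N + 1),
            (Wd X n).ncard * Real.exp (-((entropy X + ε) * n)) := by positivity
          linarith

/-! ### Proper subsystems of transitive subshifts of finite type have smaller entropy -/

/-- Symbols that occur in the subshift. -/
def Good {𝒜 : Type*} (H : 𝒜 → 𝒜 → Prop) (a : 𝒜) : Prop := ∃ x ∈ SFT H, ∃ k : ℤ, x k = a

theorem rd_subword {𝒜 : Type*} {x : Seq 𝒜} {k : ℤ} {n : ℕ} {u : List 𝒜} (h : u <:+: rd x k n) :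
    ∃ k', u = rd x k' u.length := by
  obtain ⟨s, t, h⟩ := h
  have hl : n = s.length + (u.length + t.length) := by
    have := congrArg List.length h
    simp at this
    omega
  rw [hl, rd_add, rd_add, List.append_assoc] at h
  have h1 := List.append_inj_right h (by simp)
  exact ⟨_, List.append_inj_left h1 (by simp)⟩

theorem rd_good {𝒜 : Type*} {H : 𝒜 → 𝒜 → Prop} {x : Seq 𝒜} (hx : x ∈ SFT H) (k : ℤ) (n : ℕ) :
    ∀ a ∈ rd x k n, Good H a := by
  intro a ha
  simp only [rd, List.mem_map] at ha
  obtain ⟨i, -, rfl⟩ := ha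
  exact ⟨x, hx, _, rfl⟩

/-- Extend a chain of good symbols to the right. -/
theorem chain_mem_Wd {𝒜 : Type*} {H : 𝒜 → 𝒜 → Prop} (hne : (SFT H).Nonempty) (l : List 𝒜)
    (hc : l.IsChain H) (hg : ∀ a ∈ l, Good H a) : l ∈ Wd (SFT H) l.length := by
  suffices h : ∀ l : List 𝒜, l.IsChain H → (∀ a ∈ l, Good H a) →
      ∃ x ∈ SFT H, l = rd x 0 l.length by
    obtain ⟨x, hx, h⟩ := h l hc hg
    exact ⟨x, hx, 0, h⟩
  intro l
  induction l with
  | nil => intro _ _; obtain ⟨x, hx⟩ := hne; exact ⟨x, hx, by simp [rd]⟩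
  | cons a l ih =>
    intro hc hg
    obtain ⟨y, hy, k, hk⟩ := hg a (by simp)
    obtain ⟨x, hx, hl⟩ := ih hc.tail (fun b hb => hg b (by simp [hb]))
    cases l with
    | nil =>
      refine ⟨shiftZ k y, shiftZ_mem hy k, ?_⟩
      simp [rd, shiftZ, hk]
    | cons b l =>
      have hab : H a b := (List.isChain_cons_cons.1 hc).1
      have hx0 : x 0 = b := by
        rw [List.length_cons, rd_succ] at hl
        exact (List.cons.inj hl).1.symm
      refine ⟨fun i => if i ≤ 0 then y (i + k) else x (i - 1), ?_, ?_⟩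
      · intro i
        simp only
        rcases lt_trichotomy i 0 with h | h | h
        · rw [if_pos h.le, if_pos (by omega)]
          have := hy (i + k)
          rwa [show i + 1 + k = i + k + 1 by ring]
        · subst h
          simpa [hk, hx0] using hab
        · rw [if_neg (by omega), if_neg (by omega)]
          have := hx (i - 1)
          rwa [show i + 1 - 1 = i - 1 + 1 by ring]
      · rw [List.length_cons, rd_succ]
        congr 1
        · simp [hk]
        · rw [hl]
          simp only [rd, List.length_map, List.length_range]
          apply List.map_congr_left
          intro i hi
          rw [if_neg (by omega)]
          congr 1
          ring

/-- `l` is a loop at `a`. -/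
def IsLoop {𝒜 : Type*} (H : 𝒜 → 𝒜 → Prop) (u : List 𝒜) (a : 𝒜) (l : List 𝒜) : Prop :=
  (a :: l).IsChain H ∧ l.getLast? = some a ∧ (∀ b ∈ l, Good H b) ∧ u <:+: l

theorem IsLoop.append {𝒜 : Type*} {H : 𝒜 → 𝒜 → Prop} {u : List 𝒜} {a : 𝒜} {l l' : List 𝒜}
    (h : IsLoop H u a l) (h' : IsLoop H u a l') : IsLoop H u a (l ++ l') := by
  obtain ⟨h1, h2, h3, h4⟩ := h
  obtain ⟨h1', h2', h3', h4'⟩ := h'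
  refine ⟨?_, ?_, ?_, ?_⟩
  · rw [← List.cons_append, List.isChain_append]
    refine ⟨h1, h1'.tail, ?_⟩
    intro x hx y hy
    have : x = a := by
      rw [List.getLast?_cons, h2] at hx
      simpa using hx.symm
    subst this
    cases l' with
    | nil => simp at hy
    | cons b l' =>
      simp at hy
      subst hy
      exact (List.isChain_cons_cons.1 h1').1
  · rw [List.getLast?_append, h2']; simp
  · intro b hb
    rcases List.mem_append.1 hb with hb | hb
    · exact h3 b hb
    · exact h3' b hb
  · exact h4.trans (List.infix_append' [] l l')

theorem IsLoop.mul {𝒜 : Type*} {H : 𝒜 → 𝒜 → Prop} {u : List 𝒜} {a : 𝒜} {l : List 𝒜}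
    (h : IsLoop H u a l) (n : ℕ) : ∃ l', l'.length = (n + 1) * l.length ∧ IsLoop H u a l' := by
  induction n with
  | zero => exact ⟨l, by simp, h⟩
  | succ n ih =>
    obtain ⟨l', h1, h2⟩ := ih
    exact ⟨l ++ l', by simp [h1]; ring, h.append h2⟩

theorem exists_loop {𝒜 : Type*} {H : 𝒜 → 𝒜 → Prop} (hT : IsTransitive H) {y : Seq 𝒜}
    (hy : y ∈ SFT H) (L : ℕ) {a : 𝒜} (ha : Good H a) :
    ∃ l, IsLoop H (rd y 0 L) a l := by
  obtain ⟨x, hx, hd⟩ := trans_dense hT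
  obtain ⟨z, hz, k, hk⟩ := ha
  obtain ⟨n1, -, h1⟩ := hd (shiftZ k z) (shiftZ_mem hz k) 0 0
  obtain ⟨n2, h12, h2⟩ := hd y hy L (n1 + 1)
  obtain ⟨n3, h23, h3⟩ := hd (shiftZ k z) (shiftZ_mem hz k) 0 (n2 + L)
  have e1 : x n1 = a := by have := h1 0 (by simp); simpa [shiftZ, hk] using this
  have e3 : x n3 = a := by have := h3 0 (by simp); simpa [shiftZ, hk] using this
  obtain ⟨p, rfl⟩ := Nat.exists_eq_add_of_le h12
  obtain ⟨q, rfl⟩ := Nat.exists_eq_add_of_le h23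
  refine ⟨rd x (n1 + 1) (p + (L + (q + 1 - 1) + 1)), ?_, ?_, rd_good hx _ _, ?_⟩
  · rw [← e1, ← rd_succ]
    exact rd_chain hx _ _
  · rw [← add_assoc, rd_succ']
    simp only [List.getLast?_append, List.getLast?_singleton, Option.some.injEq,
      Option.some_or]
    rw [← e3]
    congr 1
    push_cast
    ring
  · have hu : rd y 0 L = rd x (n1 + 1 + p) L := by
      simp only [rd]
      apply List.map_congr_left
      intro i hi
      have hi' := List.mem_range.1 hi
      have := h2 i (by rw [abs_of_nonneg (by positivity)]; exact_mod_cast hi'.le)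
      rw [zero_add, ← this]
      congr 1
      push_cast
      ring
    rw [hu, rd_add, add_assoc L, rd_add]
    exact ⟨_, _, List.append_assoc _ _ _⟩

theorem exists_loops {𝒜 : Type*} [Fintype 𝒜] {H : 𝒜 → 𝒜 → Prop} (hT : IsTransitive H)
    {y : Seq 𝒜} (hy : y ∈ SFT H) (L : ℕ) :
    ∃ T : ℕ, 0 < T ∧ ∃ lp : 𝒜 → List 𝒜, ∀ a, Good H a →
      (lp a).length = T ∧ IsLoop H (rd y 0 L) a (lp a) := by
  classical
  have : ∀ a, ∃ l, Good H a → IsLoop H (rd y 0 L) a l := by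
    intro a
    by_cases ha : Good H a
    · obtain ⟨l, hl⟩ := exists_loop hT hy L ha
      exact ⟨l, fun _ => hl⟩
    · exact ⟨[], fun h => absurd h ha⟩
  choose l hl using this
  let t : 𝒜 → ℕ := fun a => if Good H a then (l a).length else 1
  have ht : ∀ a, 0 < t a := by
    intro a
    simp only [t]
    split_ifs with ha
    · have := (hl a ha).2.1
      rw [List.length_pos_iff]
      rintro h
      simp [h] at this
    · norm_num
  let T := ∏ a, t a
  have hTp : 0 < T := Finset.prod_pos fun a _ => ht a
  refine ⟨T, hTp, ?_⟩
  have : ∀ a, ∃ l', Good H a → l'.length = T ∧ IsLoop H (rd y 0 L) a l' := by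
    intro a
    by_cases ha : Good H a
    · have hdvd : t a ∣ T := Finset.dvd_prod_of_mem t (Finset.mem_univ a)
      obtain ⟨c, hc⟩ := hdvd
      cases c with
      | zero => omega
      | succ c =>
        obtain ⟨l', h1, h2⟩ := (hl a ha).mul c
        refine ⟨l', fun _ => ⟨?_, h2⟩⟩
        rw [h1, hc]
        simp only [t, if_pos ha]
        ring
    · exact ⟨[], fun h => absurd h ha⟩
  choose l' hl' using this
  exact ⟨l', hl'⟩

/-- Insert loops in the word `w` cut in blocks of length `T`. -/
def enc {𝒜 : Type*} (lp : 𝒜 → List 𝒜) (T : ℕ) : List Bool → List 𝒜 → List 𝒜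
  | [], _ => []
  | b :: bs, w => w.take T ++ ((if b then (w.take T).getLast?.elim [] lp else []) ++
      enc lp T bs (w.drop T))

theorem exists_last {𝒜 : Type*} {T n : ℕ} (hT : 0 < T) {w : List 𝒜} (h : w.length = (n + 1) * T) :
    ∃ a ∈ w, (w.take T).getLast? = some a := by
  have hl : (w.take T).length = T := by
    rw [List.length_take, h]; apply min_eq_left; nlinarith
  have hne : w.take T ≠ [] := by
    rw [← List.length_pos_iff, hl]; exact hT
  exact ⟨(w.take T).getLast hne, List.mem_of_mem_take (List.getLast_mem hne),
    List.getLast?_eq_some_getLast hne⟩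

theorem enc_head {𝒜 : Type*} (lp : 𝒜 → List 𝒜) {T : ℕ} (hT : 0 < T) (bs : List Bool) (w : List 𝒜)
    (h : w.length = bs.length * T) : (enc lp T bs w).head? = w.head? := by
  cases bs with
  | nil =>
    have : w = [] := by simpa using h
    simp [enc, this]
  | cons b bs =>
    cases w with
    | nil => simp at h; omega
    | cons a w =>
      obtain ⟨T, rfl⟩ := Nat.exists_eq_succ_of_ne_zero hT.ne'
      simp [enc]

theorem enc_props {𝒜 : Type*} {H : 𝒜 → 𝒜 → Prop} {u : List 𝒜} {lp : 𝒜 → List 𝒜} {T : ℕ}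
    (hT : 0 < T) (hlp : ∀ a, Good H a → (lp a).length = T ∧ IsLoop H u a (lp a))
    (bs : List Bool) (w : List 𝒜) (h : w.length = bs.length * T) (hc : w.IsChain H)
    (hg : ∀ a ∈ w, Good H a) :
    (enc lp T bs w).length = (bs.length + bs.count true) * T ∧ (enc lp T bs w).IsChain H ∧
      ∀ a ∈ enc lp T bs w, Good H a := by
  induction bs generalizing w with
  | nil => simp [enc]
  | cons b bs ih =>
    have hlen : (w.take T).length = T := by
      rw [List.length_take, h, List.length_cons]; apply min_eq_left; nlinarith
    have hdl : (w.drop T).length = bs.length * T := by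
      rw [List.length_drop, h, List.length_cons, add_mul]; omega
    obtain ⟨a, haw, ha⟩ := exists_last hT h
    obtain ⟨i1, i2, i3⟩ := ih (w.drop T) hdl (hc.drop T)
      (fun a ha => hg a (List.mem_of_mem_drop ha))
    obtain ⟨l1, l2, l3, l4, l5⟩ := hlp a (hg a haw)
    have hsplit := hc
    rw [← List.take_append_drop T w, List.isChain_append] at hsplit
    obtain ⟨s1, s2, s3⟩ := hsplit
    have hh := enc_head lp hT bs (w.drop T) hdl
    rw [enc, ha, Option.elim_some]
    cases b with
    | false =>
      simp only [Bool.false_eq_true, if_false, List.nil_append]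
      refine ⟨?_, ?_, ?_⟩
      · rw [List.length_append, hlen, i1]
        simp
        ring
      · rw [List.isChain_append, hh]
        exact ⟨s1, i2, s3⟩
      · intro c hc'
        rcases List.mem_append.1 hc' with h' | h'
        · exact hg c (List.mem_of_mem_take h')
        · exact i3 c h'
    | true =>
      simp only [if_true]
      refine ⟨?_, ?_, ?_⟩
      · rw [List.length_append, List.length_append, hlen, i1, l1]
        simp
        ring
      · rw [List.isChain_append, List.isChain_append, hh]
        refine ⟨s1, ⟨l2.tail, i2, ?_⟩, ?_⟩
        · rw [l3]; rw [ha] at s3; exact s3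
        · rw [ha]
          intro x hx y hy
          simp at hx
          subst hx
          cases hl : lp a with
          | nil => rw [hl] at l3; simp at l3
          | cons c l =>
            rw [hl] at hy l2
            simp at hy
            subst hy
            exact (List.isChain_cons_cons.1 l2).1
      · intro c hc'
        rcases List.mem_append.1 hc' with h' | h'
        · exact hg c (List.mem_of_mem_take h')
        · rcases List.mem_append.1 h' with h' | h'
          · exact l4 c h'
          · exact i3 c h'

theorem enc_aux {𝒜 : Type*} {u : List 𝒜} {lp : 𝒜 → List 𝒜} {T : ℕ} (hT : 0 < T)
    {a : 𝒜} (h1 : (lp a).length = T) (h2 : u <:+: lp a) {bs' : List Bool} {w' E : List 𝒜}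
    (hw' : w'.length = bs'.length * T) (hu : ¬ u <:+: w')
    (h : lp a ++ E = enc lp T bs' w') : False := by
  cases bs' with
  | nil =>
    have := congrArg List.length h
    simp only [enc, List.length_append, List.length_nil] at this
    omega
  | cons b bs =>
    have hlen : (w'.take T).length = T := by
      rw [List.length_take, hw', List.length_cons]; apply min_eq_left; nlinarith
    rw [enc] at h
    have := List.append_inj_left h (by rw [h1, hlen])
    rw [this] at h2
    exact hu (h2.trans (List.take_prefix T w').isInfix)

theorem enc_inj {𝒜 : Type*} {H : 𝒜 → 𝒜 → Prop} {u : List 𝒜} {lp : 𝒜 → List 𝒜} {T : ℕ}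
    (hT : 0 < T) (hlp : ∀ a, Good H a → (lp a).length = T ∧ IsLoop H u a (lp a))
    (bs bs' : List Bool) (w w' : List 𝒜) (h : w.length = bs.length * T)
    (h' : w'.length = bs'.length * T) (hbs : bs.length = bs'.length)
    (hg : ∀ a ∈ w, Good H a)
    (hu : ¬ u <:+: w) (hu' : ¬ u <:+: w') (he : enc lp T bs w = enc lp T bs' w') :
    bs = bs' ∧ w = w' := by
  induction bs generalizing bs' w w' with
  | nil =>
    have : bs' = [] := by simpa using hbs.symm
    subst this
    refine ⟨rfl, ?_⟩
    have h1 : w = [] := by simpa using h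
    have h2 : w' = [] := by simpa using h'
    rw [h1, h2]
  | cons b bs ih =>
    cases bs' with
    | nil => simp at hbs
    | cons b' bs' =>
      have hlen : (w.take T).length = T := by
        rw [List.length_take, h, List.length_cons]; apply min_eq_left; nlinarith
      have hlen' : (w'.take T).length = T := by
        rw [List.length_take, h', List.length_cons]; apply min_eq_left; nlinarith
      have hdl : (w.drop T).length = bs.length * T := by
        rw [List.length_drop, h, List.length_cons, add_mul]; omega
      have hdl' : (w'.drop T).length = bs'.length * T := by
        rw [List.length_drop, h', List.length_cons, add_mul]; omega
      have hud : ¬ u <:+: w.drop T := fun hh => hu (hh.trans (List.drop_suffix T w).isInfix)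
      have hud' : ¬ u <:+: w'.drop T := fun hh => hu' (hh.trans (List.drop_suffix T w').isInfix)
      have hbs' : bs.length = bs'.length := by simpa using hbs
      obtain ⟨a, haw, ha⟩ := exists_last hT h
      obtain ⟨l1, l2, l3, l4, l5⟩ := hlp a (hg a haw)
      rw [enc, enc] at he
      obtain ⟨e1, e2⟩ := List.append_inj he (by rw [hlen, hlen'])
      rw [← e1, ha, Option.elim_some] at e2
      have key : ∀ hbb : enc lp T bs (w.drop T) = enc lp T bs' (w'.drop T),
          bs = bs' ∧ w = w' := by
        intro hbb
        obtain ⟨k1, k2⟩ := ih bs' (w.drop T) (w'.drop T) hdl hdl' hbs'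
          (fun a ha => hg a (List.mem_of_mem_drop ha)) hud hud' hbb
        refine ⟨k1, ?_⟩
        rw [← List.take_append_drop T w, e1, k2, List.take_append_drop]
      cases b <;> cases b' <;> simp only [Bool.false_eq_true, if_false, if_true,
        List.nil_append] at e2
      · obtain ⟨k1, k2⟩ := key e2
        exact ⟨by rw [k1], k2⟩
      · exact (enc_aux hT l1 l5 hdl hud e2.symm).elim
      · exact (enc_aux hT l1 l5 hdl' hud' e2).elim
      · obtain ⟨k1, k2⟩ := key (List.append_cancel_left e2)
        exact ⟨by rw [k1], k2⟩

theorem key_count {𝒜 : Type*} [Fintype 𝒜] {H : 𝒜 → 𝒜 → Prop} {X : Set (Seq 𝒜)}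
    (hXs : X ⊆ SFT H) (hX : X.Nonempty) {u : List 𝒜} {lp : 𝒜 → List 𝒜} {T : ℕ}
    (hT : 0 < T) (hlp : ∀ a, Good H a → (lp a).length = T ∧ IsLoop H u a (lp a))
    (hu : ∀ n, ∀ w ∈ Wd X n, ¬ u <:+: w) (h : ℝ) (hlow : ∀ n : ℕ, Real.exp (h * n) ≤ (Wd X n).ncard)
    (n : ℕ) : (1 + Real.exp (-(h * T))) ^ n ≤
      ∑ j ∈ Finset.range (2 * n * T + 1), ((Wd (SFT H) j).ncard : ℝ) * Real.exp (-(h * j)) := by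
  classical
  set F : Finset ((Fin n → Bool) × List 𝒜) :=
    (Finset.univ : Finset (Fin n → Bool)) ×ˢ (Wd_finite X (n * T)).toFinset with hF
  set Φ : (Fin n → Bool) × List 𝒜 → List 𝒜 := fun p => enc lp T (List.ofFn p.1) p.2 with hΦ
  have hmem : ∀ p ∈ F, p.2 ∈ Wd X (n * T) := by
    intro p hp
    simpa [hF] using hp
  have hp2 : ∀ p ∈ F, p.2.length = (List.ofFn p.1).length * T ∧ p.2.IsChain H ∧
      ∀ a ∈ p.2, Good H a := by
    intro p hp
    obtain ⟨x, hx, k, hk⟩ := hmem p hp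
    rw [hk]
    exact ⟨by simp, rd_chain (hXs hx) _ _, rd_good (hXs hx) _ _⟩
  have hprop := fun p hp => enc_props hT hlp (List.ofFn p.1) p.2 (hp2 p hp).1 (hp2 p hp).2.1
    (hp2 p hp).2.2
  have hinj : Set.InjOn Φ F := by
    intro p hp q hq hpq
    obtain ⟨h1, h2⟩ := enc_inj hT hlp _ _ p.2 q.2 (hp2 p hp).1 (hp2 q hq).1 (by simp)
      (hp2 p hp).2.2 (hu _ _ (hmem p hp)) (hu _ _ (hmem q hq)) hpq
    exact Prod.ext (List.ofFn_injective h1) h2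
  -- lower bound
  have hlower : (1 + Real.exp (-(h * T))) ^ n ≤ ∑ p ∈ F, Real.exp (-(h * (Φ p).length)) := by
    have hw : ∀ p ∈ F, Real.exp (-(h * (Φ p).length)) =
        Real.exp (-(h * ((n * T : ℕ) : ℝ))) *
          ∏ i : Fin n, (if p.1 i = true then Real.exp (-(h * T)) else 1) := by
      intro p hp
      have e1 : ∀ bs : List Bool, (bs.map fun b => if b = true then Real.exp (-(h * T)) else 1).prod
          = Real.exp (-(h * T)) ^ (bs.count true) := by
        intro bs
        induction bs with
        | nil => simp
        | cons b bs ih =>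
          cases b <;> simp [ih, pow_succ, mul_comm]
      have e2 := e1 (List.ofFn p.1)
      rw [List.map_ofFn, List.prod_ofFn] at e2
      simp only [Function.comp_def] at e2
      rw [e2, (hprop p hp).1, ← Real.exp_nat_mul, ← Real.exp_add]
      congr 1
      simp only [List.length_ofFn]
      push_cast
      ring
    have e3 : ∑ b : Fin n → Bool, ∏ i : Fin n, (if b i = true then Real.exp (-(h * T)) else 1) =
        (1 + Real.exp (-(h * T))) ^ n := by
      have := Finset.prod_univ_sum (fun _ : Fin n => (Finset.univ : Finset Bool))
        (fun _ b => if b = true then Real.exp (-(h * T)) else (1 : ℝ))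
      rw [Fintype.piFinset_univ] at this
      rw [← this]
      simp [add_comm]
    have e6 : ∑ p ∈ F, ∏ i : Fin n, (if p.1 i = true then Real.exp (-(h * T)) else 1) =
        (Wd_finite X (n * T)).toFinset.card * (1 + Real.exp (-(h * T))) ^ n := by
      rw [hF, Finset.sum_product_right, ← nsmul_eq_mul, ← Finset.sum_const]
      exact Finset.sum_congr rfl fun y _ => e3
    rw [Finset.sum_congr rfl hw, ← Finset.mul_sum, e6, ← mul_assoc, mul_comm (Real.exp _)]
    have e4 := hlow (n * T)
    rw [Set.ncard_eq_toFinset_card _ (Wd_finite X (n * T))] at e4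
    have e5 : 1 ≤ ((Wd_finite X (n * T)).toFinset.card : ℝ) *
        Real.exp (-(h * ((n * T : ℕ) : ℝ))) := by
      calc (1 : ℝ) = Real.exp (h * ((n * T : ℕ) : ℝ)) * Real.exp (-(h * ((n * T : ℕ) : ℝ))) := by
            rw [← Real.exp_add]; simp
        _ ≤ _ := by gcongr
    exact le_mul_of_one_le_left (by positivity) e5
  refine hlower.trans ?_
  rw [← Finset.sum_image (f := fun l : List 𝒜 => Real.exp (-(h * l.length))) hinj]
  have hmaps : ∀ l ∈ F.image Φ, l.length ∈ Finset.range (2 * n * T + 1) := by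
    intro l hl
    obtain ⟨p, hp, rfl⟩ := Finset.mem_image.1 hl
    rw [hΦ, (hprop p hp).1, Finset.mem_range, List.length_ofFn, Nat.lt_succ_iff]
    apply Nat.mul_le_mul_right
    have := List.count_le_length (a := true) (l := List.ofFn p.1)
    rw [List.length_ofFn] at this
    omega
  rw [← Finset.sum_fiberwise_of_maps_to hmaps]
  apply Finset.sum_le_sum
  intro j _
  have : ∀ l ∈ (F.image Φ).filter (fun l => l.length = j),
      Real.exp (-(h * l.length)) = Real.exp (-(h * j)) := by
    intro l hl
    rw [(Finset.mem_filter.1 hl).2]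
  rw [Finset.sum_congr rfl this, Finset.sum_const, nsmul_eq_mul]
  gcongr
  rw [Set.ncard_eq_toFinset_card _ (Wd_finite _ _)]
  apply Finset.card_le_card
  intro l hl
  obtain ⟨hl1, hl2⟩ := Finset.mem_filter.1 hl
  obtain ⟨p, hp, rfl⟩ := Finset.mem_image.1 hl1
  rw [Set.Finite.mem_toFinset, ← hl2]
  exact chain_mem_Wd (hX.mono hXs) _ (hprop p hp).2.1 (hprop p hp).2.2

theorem lang_full {𝒜 : Type*} [Fintype 𝒜] {H : 𝒜 → 𝒜 → Prop} (hTr : IsTransitive H)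
    (hEnt : 0 < entropy (SFT H)) {X : Set (Seq 𝒜)}
    (hXs : X ⊆ SFT H) (hfull : entropy X = entropy (SFT H)) (y : Seq 𝒜) (hy : y ∈ SFT H) (L : ℕ) :
    ∃ x ∈ X, ∃ k : ℤ, rd x k L = rd y 0 L := by
  by_contra hcon
  push Not at hcon
  have hX : X.Nonempty := by
    rw [Set.nonempty_iff_ne_empty]
    rintro rfl
    rw [entropy_empty] at hfull
    linarith
  obtain ⟨T, hT, lp, hlp⟩ := exists_loops hTr hy L
  have hu : ∀ n, ∀ w ∈ Wd X n, ¬ (rd y 0 L) <:+: w := by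
    rintro n w ⟨x, hx, k, rfl⟩ hin
    obtain ⟨k', hk'⟩ := rd_subword hin
    rw [rd_length] at hk'
    exact hcon x hx k' hk'.symm
  set h := entropy (SFT H) with hh
  have hlow : ∀ n : ℕ, Real.exp (h * n) ≤ (Wd X n).ncard := by
    intro n
    rw [← hfull]
    exact entropy_lower hX n
  set q := 1 + Real.exp (-(h * T)) with hq
  have hq1 : 1 < q := by
    have := Real.exp_pos (-(h * T))
    linarith
  have hlq : 0 < Real.log q := Real.log_pos hq1
  have hTR : (0 : ℝ) < T := by exact_mod_cast hT
  set ε := Real.log q / (4 * T) with hε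
  have hεp : 0 < ε := by positivity
  obtain ⟨D, hD, hup⟩ := entropy_upper (hX.mono hXs) hεp
  set s := Real.exp (Real.log q / 2) with hs
  have hs1 : 1 < s := Real.one_lt_exp_iff.2 (by positivity)
  have hss : s * s = q := by
    rw [hs, ← Real.exp_add, add_halves, Real.exp_log (by linarith)]
  have hbound : ∀ n : ℕ, s ^ n ≤ (2 * n * T + 1) * D := by
    intro n
    have h1 := key_count hXs hX hT hlp hu h hlow n
    have h2 : ∑ j ∈ Finset.range (2 * n * T + 1), ((Wd (SFT H) j).ncard : ℝ) * Real.exp (-(h * j))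
        ≤ ∑ j ∈ Finset.range (2 * n * T + 1), D * s ^ n := by
      apply Finset.sum_le_sum
      intro j hj
      have hj' : j ≤ 2 * n * T := Nat.lt_succ_iff.1 (Finset.mem_range.1 hj)
      have hj2 : (j : ℝ) ≤ 2 * n * T := by exact_mod_cast hj'
      calc ((Wd (SFT H) j).ncard : ℝ) * Real.exp (-(h * j))
          ≤ (D * Real.exp ((h + ε) * j)) * Real.exp (-(h * j)) := by
            gcongr; exact hup j
        _ = D * Real.exp (ε * j) := by
            rw [mul_assoc, ← Real.exp_add]; congr 2; ring
        _ ≤ D * Real.exp (ε * (2 * n * T)) := by gcongr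
        _ = D * s ^ n := by
            rw [hs, ← Real.exp_nat_mul, hε]; congr 2; field_simp; ring
    rw [Finset.sum_const, Finset.card_range, nsmul_eq_mul, ← hq, ← hss, mul_pow] at *
    have h3 : s ^ n * s ^ n ≤ ((2 * n * T + 1) * D) * s ^ n := by
      refine (h1.trans h2).trans (le_of_eq ?_)
      push_cast
      ring
    exact le_of_mul_le_mul_right h3 (by positivity)
  have ht := tendsto_pow_const_div_const_pow_of_one_lt 1 hs1
  have ht0 := tendsto_pow_const_div_const_pow_of_one_lt 0 hs1
  have ht2 : Tendsto (fun n : ℕ => (2 * T * D) * ((n : ℝ) ^ 1 / s ^ n) + D * ((n : ℝ) ^ 0 / s ^ n))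
      atTop (𝓝 ((2 * T * D) * 0 + D * 0)) := (ht.const_mul _).add (ht0.const_mul _)
  have ht3 : ∀ᶠ n : ℕ in atTop,
      (2 * T * D) * ((n : ℝ) ^ 1 / s ^ n) + D * ((n : ℝ) ^ 0 / s ^ n) < 1 := by
    apply ht2.eventually_lt_const
    norm_num
  obtain ⟨n, hn⟩ := ht3.exists
  have hb := hbound n
  have hsn : 0 < s ^ n := by positivity
  have : (2 * T * D) * ((n : ℝ) ^ 1 / s ^ n) + D * ((n : ℝ) ^ 0 / s ^ n) =
      ((2 * n * T + 1) * D) / s ^ n := by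
    field_simp
  rw [this, div_lt_one hsn] at hn
  linarith

section Cocycle
open scoped Matrix.Norms.L2Operator

theorem eNorm_eq {d : ℕ} (u : Fin d → ℝ) : eNorm u = ‖(WithLp.toLp 2 u : EuclideanSpace ℝ (Fin d))‖ := by
  rw [EuclideanSpace.norm_eq, eNorm]
  simp

theorem opNorm_eq {d : ℕ} (M : Matrix (Fin d) (Fin d) ℝ) : opNorm M = ‖M‖ := by
  rcases Nat.eq_zero_or_pos d with rfl | hd
  · have h1 : M = 0 := Subsingleton.elim _ _
    have h2 : {r : ℝ | ∃ u : Fin 0 → ℝ, eNorm u = 1 ∧ r = eNorm (M.mulVec u)} = ∅ := by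
      ext r
      simp [eNorm]
    rw [opNorm, h2, h1]
    simp
  · have : Nonempty (Fin d) := ⟨⟨0, hd⟩⟩
    rw [Matrix.cstar_norm_def, ← ContinuousLinearMap.sSup_sphere_eq_norm, opNorm]
    congr 1
    ext r
    simp only [Set.mem_ofPred_eq, Set.mem_image, mem_sphere_zero_iff_norm]
    constructor
    · rintro ⟨u, hu, rfl⟩
      exact ⟨WithLp.toLp 2 u, by rw [← eNorm_eq, hu], by rw [eNorm_eq]; rfl⟩
    · rintro ⟨v, hv, rfl⟩
      exact ⟨v.ofLp, by rw [eNorm_eq]; exact hv, by rw [eNorm_eq]; rfl⟩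

theorem iterN_succ' {𝒜 : Type*} {Mo : Type*} [Monoid Mo] (A : Seq 𝒜 → Mo) (n : ℕ) (x : Seq 𝒜) :
    iterN A (n + 1) x = A (shift^[n] x) * iterN A n x := by
  induction n generalizing x with
  | zero => simp [iterN]
  | succ n ih =>
    rw [iterN, ih, Function.iterate_succ_apply, mul_assoc]
    rfl

theorem iterN_add {𝒜 : Type*} {Mo : Type*} [Monoid Mo] (A : Seq 𝒜 → Mo) (n m : ℕ) (x : Seq 𝒜) :
    iterN A (n + m) x = iterN A m (shift^[n] x) * iterN A n x := by
  induction n generalizing x with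
  | zero => simp [iterN]
  | succ n ih =>
    rw [show n + 1 + m = n + m + 1 by ring, iterN, ih, Function.iterate_succ_apply, mul_assoc]
    rfl

theorem shiftInv_iter {𝒜 : Type*} (n : ℕ) (x : Seq 𝒜) : shiftInv^[n] x = shiftZ (-(n : ℤ)) x := by
  induction n generalizing x with
  | zero => funext i; simp [shiftZ]
  | succ n ih =>
    rw [Function.iterate_succ_apply, ih]
    funext i
    simp only [shiftZ, shiftInv]
    congr 1
    push_cast
    ring

theorem shift_iter_eq {𝒜 : Type*} (n : ℕ) (x : Seq 𝒜) : shift^[n] x = shiftZ n x := by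
  funext i; rw [shift_iter]; rfl

theorem iterZ_succ {𝒜 : Type*} {Gr : Type*} [Group Gr] (A : Seq 𝒜 → Gr) (j : ℤ) (y : Seq 𝒜) :
    iterZ A (j + 1) y = A (shiftZ j y) * iterZ A j y := by
  rcases lt_or_ge j 0 with hj | hj
  · obtain ⟨m, rfl⟩ : ∃ m : ℕ, j = -((m : ℤ) + 1) := ⟨(-j - 1).toNat, by omega⟩
    have h2 : iterZ A (-((m : ℤ) + 1)) y = (iterN A (m + 1) (shiftZ (-((m : ℤ) + 1)) y))⁻¹ := by
      rw [iterZ, if_neg (by omega), shiftInv_iter]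
      have : (- -((m : ℤ) + 1)).toNat = m + 1 := by omega
      rw [this]
      push_cast
      rfl
    have h1 : iterZ A (-((m : ℤ) + 1) + 1) y = (iterN A m (shiftZ (-(m : ℤ)) y))⁻¹ := by
      rcases Nat.eq_zero_or_pos m with rfl | hm
      · simp [iterZ, iterN]
      · rw [iterZ, if_neg (by omega), shiftInv_iter]
        have : (-(-((m : ℤ) + 1) + 1)).toNat = m := by omega
        rw [this]
    have h3 : shift (shiftZ (-((m : ℤ) + 1)) y) = shiftZ (-(m : ℤ)) y := by
      funext i
      simp only [shift, shiftZ]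
      congr 1
      ring
    rw [h1, h2, iterN, h3]
    simp
  · obtain ⟨m, rfl⟩ := Int.eq_ofNat_of_zero_le hj
    rw [iterZ, if_pos (by omega), iterZ, if_pos (by omega)]
    have h1 : ((m : ℤ) + 1).toNat = m + 1 := by omega
    rw [h1, Int.toNat_natCast, iterN_succ', shift_iter_eq]

theorem iterN_shiftZ {𝒜 : Type*} {Gr : Type*} [Group Gr] (A : Seq 𝒜 → Gr) (j : ℤ) (y : Seq 𝒜)
    (n : ℕ) : iterN A n (shiftZ j y) = iterZ A (j + n) y * (iterZ A j y)⁻¹ := by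
  induction n with
  | zero => simp [iterN]
  | succ n ih =>
    rw [iterN_succ', ih, Nat.cast_succ, ← add_assoc, iterZ_succ, shift_iter_eq, mul_assoc]
    congr 2
    funext i
    simp only [shiftZ]
    congr 1
    ring

/-- Quantitative continuity of `A`. -/
def Hol {𝒜 : Type*} {d : ℕ} (H : 𝒜 → 𝒜 → Prop) (A : Seq 𝒜 → GL (Fin d) ℝ) (C ρ : ℝ) : Prop :=
  0 ≤ C ∧ 0 < ρ ∧ ρ < 1 ∧ ∀ m : ℕ, ∀ x ∈ SFT H, ∀ y ∈ SFT H, agree m x y →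
    ‖(A x).val - (A y).val‖ ≤ C * ρ ^ m

theorem hol_of_holder {𝒜 : Type*} {d : ℕ} {H : 𝒜 → 𝒜 → Prop} {A : Seq 𝒜 → GL (Fin d) ℝ} {α : ℝ}
    (hα : 0 < α) (h : IsHolder H A α) : ∃ C ρ : ℝ, Hol H A C ρ := by
  obtain ⟨C, hC⟩ := h
  refine ⟨|C|, (2 : ℝ) ^ (-α), abs_nonneg _, by positivity,
    Real.rpow_lt_one_of_one_lt_of_neg (by norm_num) (by linarith), ?_⟩
  intro m x hx y hy hxy
  have h1 := hC x hx y hy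
  rw [opNorm_eq] at h1
  refine h1.trans ?_
  have h2 := dist_of_agree hxy
  have h3 : seqDist x y ^ α ≤ ((2 : ℝ) ^ (-α)) ^ m := by
    calc seqDist x y ^ α ≤ ((2 : ℝ) ^ (-(m : ℤ))) ^ α :=
          Real.rpow_le_rpow (dist_nonneg' x y) h2 hα.le
      _ = ((2 : ℝ) ^ (-α)) ^ m := by
          rw [← Real.rpow_intCast, ← Real.rpow_mul (by norm_num), ← Real.rpow_natCast,
            ← Real.rpow_mul (by norm_num)]
          congr 1
          push_cast
          ring
  calc C * seqDist x y ^ α ≤ |C| * seqDist x y ^ α := by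
        gcongr
        · exact Real.rpow_nonneg (dist_nonneg' x y) _
        · exact le_abs_self C
    _ ≤ _ := by gcongr

/-- Convergence in the sequence space. -/
def Conv {𝒜 : Type*} (z : ℕ → Seq 𝒜) (x : Seq 𝒜) : Prop :=
  ∀ m : ℕ, ∀ᶠ k in atTop, agree m (z k) x

theorem Conv.shift {𝒜 : Type*} {z : ℕ → Seq 𝒜} {x : Seq 𝒜} (h : Conv z x) :
    Conv (fun k => shift (z k)) (shift x) := by
  intro m
  filter_upwards [h (m + 1)] with k hk i hi
  refine hk (i + 1) ?_
  rw [abs_le] at *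
  push_cast
  omega

theorem conv_of_agree {𝒜 : Type*} {z : ℕ → Seq 𝒜} {x : Seq 𝒜} (h : ∀ k, agree k (z k) x) :
    Conv z x := by
  intro m
  filter_upwards [eventually_ge_atTop m] with k hk i hi
  exact h k i (hi.trans (by exact_mod_cast hk))

theorem Hol.tendsto {𝒜 : Type*} {d : ℕ} {H : 𝒜 → 𝒜 → Prop} {A : Seq 𝒜 → GL (Fin d) ℝ} {C ρ : ℝ}
    (h : Hol H A C ρ) {z : ℕ → Seq 𝒜} (hz : ∀ k, z k ∈ SFT H) {x : Seq 𝒜} (hx : x ∈ SFT H)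
    (hc : Conv z x) : Tendsto (fun k => (A (z k)).val) atTop (𝓝 (A x).val) := by
  obtain ⟨hC, h0, h1, hh⟩ := h
  rw [tendsto_iff_norm_sub_tendsto_zero, Metric.tendsto_atTop]
  intro ε hε
  have : Tendsto (fun m : ℕ => C * ρ ^ m) atTop (𝓝 (C * 0)) :=
    (tendsto_pow_atTop_nhds_zero_of_lt_one h0.le h1).const_mul C
  rw [mul_zero] at this
  obtain ⟨m, hm⟩ := (this.eventually_lt_const hε).exists
  obtain ⟨N, hN⟩ := eventually_atTop.1 (hc m)
  refine ⟨N, fun k hk => ?_⟩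
  rw [Real.dist_eq, sub_zero, abs_of_nonneg (norm_nonneg _)]
  exact (hh m _ (hz k) _ hx (hN k hk)).trans_lt hm

theorem Hol.tendsto_iter {𝒜 : Type*} {d : ℕ} {H : 𝒜 → 𝒜 → Prop} {A : Seq 𝒜 → GL (Fin d) ℝ}
    {C ρ : ℝ} (h : Hol H A C ρ) (n : ℕ) {z : ℕ → Seq 𝒜} (hz : ∀ k, z k ∈ SFT H) {x : Seq 𝒜}
    (hx : x ∈ SFT H) (hc : Conv z x) :
    Tendsto (fun k => (iterN A n (z k)).val) atTop (𝓝 (iterN A n x).val) := by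
  induction n generalizing z x with
  | zero => simp [iterN]
  | succ n ih =>
    simp only [iterN, Units.val_mul]
    exact (ih (fun k => shift_mem (hz k)) (shift_mem hx) hc.shift).mul (h.tendsto hz hx hc)

theorem tendsto_inv_unit {d : ℕ} {g : ℕ → GL (Fin d) ℝ} {g0 : GL (Fin d) ℝ}
    (h : Tendsto (fun k => (g k).val) atTop (𝓝 g0.val)) :
    Tendsto (fun k => ((g k)⁻¹).val) atTop (𝓝 (g0⁻¹).val) := by
  have h1 := (NormedRing.inverse_continuousAt g0).tendsto.comp h
  simpa [Function.comp_def, Ring.inverse_unit] using h1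

/-- Uniform boundedness of the cocycle. -/
def Bdd {𝒜 : Type*} {d : ℕ} (H : 𝒜 → 𝒜 → Prop) (A : Seq 𝒜 → GL (Fin d) ℝ) (K : ℝ) : Prop :=
  0 ≤ K ∧ ∀ x ∈ SFT H, ∀ n : ℕ, ‖(iterN A n x).val‖ ≤ K ∧ ‖((iterN A n x)⁻¹).val‖ ≤ K

theorem bdd_of_full {𝒜 : Type*} [Fintype 𝒜] {d : ℕ} {H : 𝒜 → 𝒜 → Prop}
    (hTr : IsTransitive H) (hEnt : 0 < entropy (SFT H)) {A : Seq 𝒜 → GL (Fin d) ℝ} {C ρ κ : ℝ}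
    (hH : Hol H A C ρ) (hκ : 0 < κ) (hfull : entropy (BSet H A κ) = entropy (SFT H)) :
    Bdd H A (κ * κ) := by
  refine ⟨by positivity, fun x hx n => ?_⟩
  have hsub : BSet H A κ ⊆ SFT H := fun x hx => hx.1
  have key : ∀ m : ℕ, ∃ z ∈ SFT H, agree m z x ∧ ‖(iterN A n z).val‖ ≤ κ * κ ∧
      ‖((iterN A n z)⁻¹).val‖ ≤ κ * κ := by
    intro m
    obtain ⟨b, hb, k, hk⟩ := lang_full hTr hEnt hsub hfull (shiftZ (-(m : ℤ)) x)
      (shiftZ_mem hx _) (2 * m + 1)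
    refine ⟨shiftZ (k + m) b, shiftZ_mem hb.1 _, ?_, ?_, ?_⟩
    · intro i hi
      rw [abs_le] at hi
      obtain ⟨p, hp⟩ : ∃ p : ℕ, i = (p : ℤ) - m := ⟨(i + m).toNat, by omega⟩
      have hp' : p < 2 * m + 1 := by omega
      have h1 := congrArg (fun l => l[p]?) hk
      simp only [rd, List.getElem?_map, List.getElem?_range hp', Option.map_some,
        Option.some.injEq, shiftZ] at h1
      rw [hp]
      simp only [shiftZ]
      rw [show (p : ℤ) - m + (k + m) = k + p by ring, h1]
      congr 1
      ring
    · rw [iterN_shiftZ, Units.val_mul]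
      refine (norm_mul_le _ _).trans ?_
      have h1 := (hb.2 (k + m + n)).1
      have h2 := (hb.2 (k + m)).2
      rw [opNorm_eq] at h1 h2
      exact mul_le_mul h1 h2 (norm_nonneg _) hκ.le
    · rw [iterN_shiftZ, _root_.mul_inv_rev, inv_inv, Units.val_mul]
      refine (norm_mul_le _ _).trans ?_
      have h1 := (hb.2 (k + m)).1
      have h2 := (hb.2 (k + m + n)).2
      rw [opNorm_eq] at h1 h2
      exact mul_le_mul h1 h2 (norm_nonneg _) hκ.le
  choose z hz hzx h1 h2 using key
  have ht := hH.tendsto_iter n hz hx (conv_of_agree hzx)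
  exact ⟨le_of_tendsto ht.norm (Eventually.of_forall h1),
    le_of_tendsto (tendsto_inv_unit ht).norm (Eventually.of_forall h2)⟩

theorem distortion {𝒜 : Type*} {d : ℕ} {H : 𝒜 → 𝒜 → Prop} {A : Seq 𝒜 → GL (Fin d) ℝ} {C ρ K : ℝ}
    (hH : Hol H A C ρ) (hB : Bdd H A K) : ∃ E : ℝ, ∀ m n : ℕ, ∀ w ∈ SFT H, ∀ z ∈ SFT H,
      (∀ i : ℤ, -(m : ℤ) ≤ i → i ≤ n + m → w i = z i) →
      ‖(iterN A n z).val - (iterN A n w).val‖ ≤ E * ρ ^ m := by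
  obtain ⟨hC, h0, h1, hh⟩ := hH
  obtain ⟨hK0, hK⟩ := hB
  refine ⟨K * (K * C * K * (2 * (1 - ρ)⁻¹)), fun m n w hw z hz hwz => ?_⟩
  set D : ℕ → Matrix (Fin d) (Fin d) ℝ := fun j => ((iterN A j w)⁻¹ * iterN A j z : GL (Fin d) ℝ).val
    with hD
  have hstep : ∀ {j : ℕ}, j < n → dist (D j) (D (j + 1)) ≤
      K * C * K * ρ ^ m * (ρ ^ j + ρ ^ (n - 1 - j)) := by
    intro j hj
    have hag : agree (m + min j (n - 1 - j)) (shift^[j] w) (shift^[j] z) := by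
      intro i hi
      rw [shift_iter, shift_iter]
      rw [abs_le] at hi
      apply hwz <;> (push_cast at hi; omega)
    have e1 := hh _ _ (shift_iter_mem hw j) _ (shift_iter_mem hz j) hag
    have e2 : D j - D (j + 1) = ((iterN A (j + 1) w)⁻¹).val *
        (((A (shift^[j] w)).val - (A (shift^[j] z)).val) * (iterN A j z).val) := by
      simp only [hD]
      rw [sub_mul, mul_sub, ← Units.val_mul, ← Units.val_mul, ← Units.val_mul, ← Units.val_mul,
        iterN_succ', iterN_succ']
      congr 2
      group
    have e3 : ρ ^ (min j (n - 1 - j)) ≤ ρ ^ j + ρ ^ (n - 1 - j) := by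
      rcases min_cases j (n - 1 - j) with ⟨h, -⟩ | ⟨h, -⟩ <;> rw [h]
      · have : 0 < ρ ^ (n - 1 - j) := by positivity
        linarith
      · have : 0 < ρ ^ j := by positivity
        linarith
    rw [dist_eq_norm, e2]
    calc _ ≤ K * ((C * ρ ^ (m + min j (n - 1 - j))) * K) := by
          refine (norm_mul_le _ _).trans ?_
          refine mul_le_mul (hK w hw _).2 ?_ (norm_nonneg _) hK0
          refine (norm_mul_le _ _).trans ?_
          exact mul_le_mul e1 (hK z hz _).1 (norm_nonneg _) (by positivity)
      _ = K * C * K * ρ ^ m * ρ ^ (min j (n - 1 - j)) := by rw [pow_add]; ring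
      _ ≤ _ := by gcongr
  have hsum := dist_le_range_sum_of_dist_le n hstep
  have hgeo : ∑ j ∈ Finset.range n, ρ ^ j ≤ (1 - ρ)⁻¹ := by
    rw [← one_div, le_div_iff₀ (by linarith), mul_comm, mul_neg_geom_sum]
    have : 0 < ρ ^ n := by positivity
    linarith
  rw [← Finset.mul_sum, Finset.sum_add_distrib, Finset.sum_range_reflect (fun j => ρ ^ j)] at hsum
  have e4 : (iterN A n z).val - (iterN A n w).val = (iterN A n w).val * (D n - D 0) := by
    simp only [hD, iterN]
    rw [mul_sub, ← Units.val_mul, ← Units.val_mul]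
    simp
  rw [e4]
  rw [dist_comm, dist_eq_norm] at hsum
  calc _ ≤ K * (K * C * K * ρ ^ m * (2 * (1 - ρ)⁻¹)) := by
        refine (norm_mul_le _ _).trans ?_
        refine mul_le_mul (hK w hw _).1 (hsum.trans ?_) (norm_nonneg _) hK0
        gcongr
        linarith
    _ = _ := by ring
end Cocycle

section Groupoid
open scoped Matrix.Norms.L2Operator

/-- `g` is a limit of the cocycle along orbit segments from near `x` to near `y`. -/
def Rch {𝒜 : Type*} {d : ℕ} (H : 𝒜 → 𝒜 → Prop) (A : Seq 𝒜 → GL (Fin d) ℝ) (x y : Seq 𝒜)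
    (g : Matrix (Fin d) (Fin d) ℝ) : Prop :=
  ∀ m : ℕ, ∀ ε : ℝ, 0 < ε → ∃ z ∈ SFT H, ∃ n : ℕ, agree m z x ∧ agree m (shift^[n] z) y ∧
    ‖(iterN A n z).val - g‖ < ε

variable {𝒜 : Type*} {d : ℕ} {H : 𝒜 → 𝒜 → Prop} {A : Seq 𝒜 → GL (Fin d) ℝ} {C ρ K : ℝ}

theorem agree_trans {m : ℕ} {x y z : Seq 𝒜} (h : agree m x y) (h' : agree m y z) : agree m x z :=
  fun i hi => (h i hi).trans (h' i hi)

theorem Rch.seq {x y : Seq 𝒜} {g : Matrix (Fin d) (Fin d) ℝ} (h : Rch H A x y g) :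
    ∃ (z : ℕ → Seq 𝒜) (n : ℕ → ℕ), (∀ k, z k ∈ SFT H) ∧ (∀ k, agree k (z k) x) ∧
      (∀ k, agree k (shift^[n k] (z k)) y) ∧
      Tendsto (fun k => (iterN A (n k) (z k)).val) atTop (𝓝 g) := by
  have := fun k : ℕ => h k (1 / ((k : ℝ) + 1)) (by positivity)
  choose z hz n h1 h2 h3 using this
  refine ⟨z, n, hz, h1, h2, ?_⟩
  rw [tendsto_iff_norm_sub_tendsto_zero]
  exact squeeze_zero (fun _ => norm_nonneg _) (fun k => (h3 k).le)
    tendsto_one_div_add_atTop_nhds_zero_nat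

theorem Rch_of_seq {x y : Seq 𝒜} {g : Matrix (Fin d) (Fin d) ℝ} (z : ℕ → Seq 𝒜) (n : ℕ → ℕ)
    (hz : ∀ k, z k ∈ SFT H) (h1 : Conv z x) (h2 : Conv (fun k => shift^[n k] (z k)) y)
    (h3 : Tendsto (fun k => (iterN A (n k) (z k)).val) atTop (𝓝 g)) : Rch H A x y g := by
  intro m ε hε
  have h4 := (tendsto_iff_norm_sub_tendsto_zero.1 h3).eventually_lt_const hε
  obtain ⟨k, k1, k2, k3⟩ := ((h1 m).and ((h2 m).and h4)).exists
  exact ⟨z k, hz k, n k, k1, k2, k3⟩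

theorem Rch_closed {x y : Seq 𝒜} {g : Matrix (Fin d) (Fin d) ℝ} {ys : ℕ → Seq 𝒜}
    {gs : ℕ → Matrix (Fin d) (Fin d) ℝ} (h : ∀ k, Rch H A x (ys k) (gs k)) (hy : Conv ys y)
    (hg : Tendsto gs atTop (𝓝 g)) : Rch H A x y g := by
  intro m ε hε
  have h4 := (tendsto_iff_norm_sub_tendsto_zero.1 hg).eventually_lt_const (half_pos hε)
  obtain ⟨k, k1, k2⟩ := ((hy m).and h4).exists
  obtain ⟨z, hz, n, h1, h2, h3⟩ := h k m (ε / 2) (half_pos hε)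
  refine ⟨z, hz, n, h1, agree_trans h2 k1, ?_⟩
  calc ‖(iterN A n z).val - g‖ = ‖((iterN A n z).val - gs k) + (gs k - g)‖ := by
        rw [sub_add_sub_cancel]
    _ ≤ _ := norm_add_le _ _
    _ < ε := by linarith

theorem Rch_step {x : Seq 𝒜} (hx : x ∈ SFT H) : Rch H A x (shift x) (A x).val := by
  intro m ε hε
  refine ⟨x, hx, 1, fun _ _ => rfl, fun _ _ => rfl, ?_⟩
  simpa [iterN] using hε

theorem Rch_norm (hB : Bdd H A K) {x y : Seq 𝒜} {g : Matrix (Fin d) (Fin d) ℝ}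
    (h : Rch H A x y g) : ‖g‖ ≤ K := by
  obtain ⟨z, n, hz, -, -, ht⟩ := h.seq
  exact le_of_tendsto ht.norm (Eventually.of_forall fun k => (hB.2 _ (hz k) _).1)

theorem proper_mat : ProperSpace (Matrix (Fin d) (Fin d) ℝ) := FiniteDimensional.proper_real _

theorem Rch_unit (hB : Bdd H A K) {x y : Seq 𝒜} {g : Matrix (Fin d) (Fin d) ℝ}
    (h : Rch H A x y g) : IsUnit g := by
  obtain ⟨z, n, hz, -, -, ht⟩ := h.seq
  have := proper_mat (d := d)
  have hb : ∀ k, ((iterN A (n k) (z k))⁻¹).val ∈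
      Metric.closedBall (0 : Matrix (Fin d) (Fin d) ℝ) K := by
    intro k
    rw [mem_closedBall_zero_iff]
    exact (hB.2 _ (hz k) _).2
  obtain ⟨g', -, φ, hφ, hg'⟩ := (isCompact_closedBall _ _).tendsto_subseq hb
  have h1 := (ht.comp hφ.tendsto_atTop).mul hg'
  have h2 : g * g' = 1 := by
    refine tendsto_nhds_unique h1 ?_
    refine Tendsto.congr (fun k => ?_) tendsto_const_nhds
    simp only [Function.comp_apply]
    rw [← Units.val_mul, mul_inv_cancel, Units.val_one]
  exact IsUnit.of_mul_eq_one _ h2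

theorem Rch_compact (hB : Bdd H A K) (x y : Seq 𝒜) : IsCompact {g | Rch H A x y g} := by
  have := proper_mat (d := d)
  refine (isCompact_closedBall (0 : Matrix (Fin d) (Fin d) ℝ) K).of_isClosed_subset ?_ ?_
  · rw [← isSeqClosed_iff_isClosed]
    intro gs g hgs hg
    exact Rch_closed hgs (conv_of_agree fun k _ _ => rfl) hg
  · intro g hg
    rw [mem_closedBall_zero_iff]
    exact Rch_norm hB hg

theorem Rch_nonempty (hT : IsTransitive H) (hB : Bdd H A K) {x y : Seq 𝒜} (hx : x ∈ SFT H)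
    (hy : y ∈ SFT H) : ∃ g, Rch H A x y g := by
  obtain ⟨s, hs, hd⟩ := trans_dense hT
  have key : ∀ m : ℕ, ∃ z ∈ SFT H, ∃ n : ℕ, agree m z x ∧ agree m (shift^[n] z) y := by
    intro m
    obtain ⟨a, -, ha⟩ := hd x hx m 0
    obtain ⟨b, hab, hb⟩ := hd y hy m a
    obtain ⟨c, rfl⟩ := Nat.exists_eq_add_of_le hab
    refine ⟨shift^[a] s, shift_iter_mem hs a, c, ?_, ?_⟩
    · intro i hi
      rw [shift_iter]
      exact ha i hi
    · intro i hi
      rw [← Function.iterate_add_apply, shift_iter, ← hb i hi, add_comm c a]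
  choose z hz n h1 h2 using key
  have := proper_mat (d := d)
  have hb : ∀ k, (iterN A (n k) (z k)).val ∈
      Metric.closedBall (0 : Matrix (Fin d) (Fin d) ℝ) K := by
    intro k
    rw [mem_closedBall_zero_iff]
    exact (hB.2 _ (hz k) _).1
  obtain ⟨g, -, φ, hφ, hg⟩ := (isCompact_closedBall _ _).tendsto_subseq hb
  refine ⟨g, Rch_of_seq (z ∘ φ) (n ∘ φ) (fun k => hz _) ?_ ?_ hg⟩
  · intro m
    exact hφ.tendsto_atTop.eventually (conv_of_agree h1 m)
  · intro m
    exact hφ.tendsto_atTop.eventually (conv_of_agree (z := fun k => shift^[n k] (z k)) h2 m)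

theorem Rch_comp (hH : Hol H A C ρ) (hB : Bdd H A K) {x y t : Seq 𝒜}
    {g g' : Matrix (Fin d) (Fin d) ℝ} (h : Rch H A x y g) (h' : Rch H A y t g') :
    Rch H A x t (g' * g) := by
  obtain ⟨E, hE⟩ := distortion hH hB
  obtain ⟨z, n, hz, z1, z2, hg⟩ := h.seq
  obtain ⟨z', n', hz', z1', z2', hg'⟩ := h'.seq
  set w : ℕ → Seq 𝒜 := fun k i => if i ≤ n k then z k i else z' k (i - n k) with hw
  have hwz : ∀ k : ℕ, ∀ i : ℤ, i ≤ n k + k → w k i = z k i := by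
    intro k i hi
    simp only [hw]
    split_ifs with h1
    · rfl
    · have e1 := z2 k (i - n k) (by rw [abs_le]; omega)
      have e2 := z1' k (i - n k) (by rw [abs_le]; omega)
      rw [shift_iter] at e1
      rw [e2, ← e1]
      congr 1
      ring
  have hwz' : ∀ k : ℕ, ∀ i : ℤ, -(k : ℤ) ≤ i → w k (i + n k) = z' k i := by
    intro k i hi
    simp only [hw]
    split_ifs with h1
    · have e1 := z2 k i (by rw [abs_le]; omega)
      have e2 := z1' k i (by rw [abs_le]; omega)
      rw [shift_iter] at e1
      rw [e2, ← e1]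
    · congr 1
      ring
  have hwS : ∀ k, w k ∈ SFT H := by
    intro k i
    rcases lt_or_ge i (n k) with h1 | h1
    · rw [hwz k i (by omega), hwz k (i + 1) (by omega)]
      exact hz k i
    · have e1 := hwz' k (i - n k) (by omega)
      have e2 := hwz' k (i - n k + 1) (by omega)
      rw [show i - (n k : ℤ) + n k = i by ring] at e1
      rw [show i - (n k : ℤ) + 1 + n k = i + 1 by ring] at e2
      rw [e1, e2]
      exact hz' k _
  have hlim : Tendsto (fun k : ℕ => E * ρ ^ k) atTop (𝓝 0) := by
    have := (tendsto_pow_atTop_nhds_zero_of_lt_one hH.2.1.le hH.2.2.1).const_mul E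
    rwa [mul_zero] at this
  have hA1 : Tendsto (fun k => (iterN A (n k) (w k)).val) atTop (𝓝 g) := by
    have e : Tendsto (fun k => (iterN A (n k) (w k)).val - (iterN A (n k) (z k)).val) atTop
        (𝓝 0) := by
      refine squeeze_zero_norm (fun k => hE k (n k) (z k) (hz k) (w k) (hwS k) ?_) hlim
      intro i _ hi
      exact (hwz k i hi).symm
    simpa using e.add hg
  have hA2 : Tendsto (fun k => (iterN A (n' k) (shift^[n k] (w k))).val) atTop (𝓝 g') := by
    have e : Tendsto (fun k => (iterN A (n' k) (shift^[n k] (w k))).val -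
        (iterN A (n' k) (z' k)).val) atTop (𝓝 0) := by
      refine squeeze_zero_norm (fun k => hE k (n' k) (z' k) (hz' k) _
        (shift_iter_mem (hwS k) _) ?_) hlim
      intro i hi _
      rw [shift_iter]
      exact (hwz' k i hi).symm
    simpa using e.add hg'
  refine Rch_of_seq w (fun k => n k + n' k) hwS (conv_of_agree ?_) (conv_of_agree ?_) ?_
  · intro k i hi
    rw [hwz k i (by rw [abs_le] at hi; omega)]
    exact z1 k i hi
  · intro k i hi
    have e := z2' k i hi
    rw [shift_iter] at e ⊢
    rw [← e, ← hwz' k _ (by rw [abs_le] at hi; omega)]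
    congr 1
    push_cast
    ring
  · simp only [iterN_add, Units.val_mul]
    exact hA2.mul hA1

theorem Rch_inv (hT : IsTransitive H) (hH : Hol H A C ρ) (hB : Bdd H A K) {x y : Seq 𝒜}
    (hx : x ∈ SFT H) (hy : y ∈ SFT H)
    {g : Matrix (Fin d) (Fin d) ℝ} (h : Rch H A x y g) :
    ∃ g', Rch H A y x g' ∧ g' * g = 1 ∧ g * g' = 1 := by
  obtain ⟨s0, hs0⟩ := Rch_nonempty hT hB hy hx
  obtain ⟨e, ⟨s, hs, rfl⟩, he⟩ := exists_idempotent_in_compact_subsemigroup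
    (M := Matrix (Fin d) (Fin d) ℝ) (fun r => continuous_id.mul continuous_const)
    ((fun s => s * g) '' {s | Rch H A y x s}) ⟨_, s0, hs0, rfl⟩
    ((Rch_compact hB y x).image (continuous_id.mul continuous_const)) (by
      rintro _ ⟨s, hs, rfl⟩ _ ⟨t, ht, rfl⟩
      refine ⟨s * g * t, ?_, by simp only [mul_assoc]⟩
      have := Rch_comp hH hB (Rch_comp hH hB ht h) hs
      simpa [mul_assoc] using this)
  have hu : IsUnit (s * g) := (Rch_unit hB hs).mul (Rch_unit hB h)
  have h1 : s * g = 1 := by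
    have : (s * g) * (s * g) = (s * g) * 1 := by rw [mul_one]; exact he
    exact hu.mul_left_cancel this
  exact ⟨s, hs, h1, mul_eq_one_comm.1 h1⟩
end Groupoid

section InvForm

variable {d : ℕ}

/-- Squared Frobenius norm. -/
def fro (M : Matrix (Fin d) (Fin d) ℝ) : ℝ := ∑ i, ∑ j, M i j ^ 2

theorem fro_continuous : Continuous (fro (d := d)) := by
  unfold fro; fun_prop

theorem fro_nonneg (M : Matrix (Fin d) (Fin d) ℝ) : 0 ≤ fro M := by
  unfold fro; positivity

theorem fro_eq_zero {M : Matrix (Fin d) (Fin d) ℝ} (h : fro M ≤ 0) : M = 0 := by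
  have h0 : fro M = 0 := le_antisymm h (fro_nonneg M)
  unfold fro at h0
  rw [Finset.sum_eq_zero_iff_of_nonneg (fun i _ => by positivity)] at h0
  ext i j
  have h1 := h0 i (Finset.mem_univ _)
  rw [Finset.sum_eq_zero_iff_of_nonneg (fun i _ => by positivity)] at h1
  simpa using h1 j (Finset.mem_univ _)

theorem fro_par (M N : Matrix (Fin d) (Fin d) ℝ) :
    fro ((1 / 2 : ℝ) • (M + N)) = (fro M + fro N) / 2 - fro (M - N) / 4 := by
  unfold fro
  rw [← Finset.sum_add_distrib, Finset.sum_div, Finset.sum_div, ← Finset.sum_sub_distrib]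
  refine Finset.sum_congr rfl fun i _ => ?_
  rw [← Finset.sum_add_distrib, Finset.sum_div, Finset.sum_div, ← Finset.sum_sub_distrib]
  refine Finset.sum_congr rfl fun j _ => ?_
  simp only [Matrix.smul_apply, Matrix.add_apply, Matrix.sub_apply, smul_eq_mul]
  ring

theorem fro_mulVec (M : Matrix (Fin d) (Fin d) ℝ) (v : Fin d → ℝ) :
    (Mᵀ *ᵥ v) ⬝ᵥ (Mᵀ *ᵥ v) ≤ fro M * (v ⬝ᵥ v) := by
  unfold fro
  rw [Finset.sum_comm, Finset.sum_mul]
  unfold dotProduct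
  refine Finset.sum_le_sum fun i _ => ?_
  have := Finset.sum_mul_sq_le_sq_mul_sq Finset.univ (fun j => M j i) v
  simp only [Matrix.mulVec, dotProduct, Matrix.transpose_apply, ← sq] at *
  exact this

theorem conj_form (g M : Matrix (Fin d) (Fin d) ℝ) (u : Fin d → ℝ) :
    u ⬝ᵥ ((g * M * gᵀ) *ᵥ u) = (gᵀ *ᵥ u) ⬝ᵥ (M *ᵥ (gᵀ *ᵥ u)) := by
  rw [← Matrix.mulVec_mulVec, ← Matrix.mulVec_mulVec, Matrix.dotProduct_mulVec,
    ← Matrix.mulVec_transpose]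

theorem exists_inv_form (G : Set (Matrix (Fin d) (Fin d) ℝ)) (hG : IsCompact G) (h1 : 1 ∈ G)
    (hmul : ∀ g ∈ G, ∀ h ∈ G, g * h ∈ G) (hinv : ∀ g ∈ G, ∃ g' ∈ G, g' * g = 1 ∧ g * g' = 1) :
    ∃ N : Matrix (Fin d) (Fin d) ℝ, N.PosDef ∧ ∀ g ∈ G, g * N * gᵀ = N := by
  obtain ⟨B, hB⟩ := hG.bddAbove_image (f := fro) fro_continuous.continuousOn
  obtain ⟨R, hR⟩ := hG.bddAbove_image (f := fun g => fro (g * 1 * gᵀ))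
    (fro_continuous.comp (by fun_prop)).continuousOn
  have hB' : ∀ g ∈ G, fro g ≤ |B| + 1 := fun g hg =>
    (hB ⟨g, hg, rfl⟩).trans ((le_abs_self B).trans (by linarith))
  have hR' : ∀ g ∈ G, fro (g * 1 * gᵀ) ≤ R := fun g hg => hR ⟨g, hg, rfl⟩
  set B' := |B| + 1 with hB'def
  have hBpos : 0 < B' := by positivity
  -- the compact convex invariant set
  let Cs : Set (Matrix (Fin d) (Fin d) ℝ) := {M | Mᵀ = M ∧ ∀ g ∈ G,
    (∀ u : Fin d → ℝ, u ⬝ᵥ u ≤ B' * (u ⬝ᵥ ((g * M * gᵀ) *ᵥ u))) ∧ fro (g * M * gᵀ) ≤ R}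
  have hone : (1 : Matrix (Fin d) (Fin d) ℝ) ∈ Cs := by
    refine ⟨Matrix.transpose_one, fun g hg => ⟨fun u => ?_, hR' g hg⟩⟩
    obtain ⟨g', hg', e1, e2⟩ := hinv g hg
    rw [conj_form, Matrix.one_mulVec]
    have e3 : g'ᵀ *ᵥ (gᵀ *ᵥ u) = u := by
      rw [Matrix.mulVec_mulVec, ← Matrix.transpose_mul, e2, Matrix.transpose_one,
        Matrix.one_mulVec]
    have e4 := fro_mulVec g' (gᵀ *ᵥ u)
    rw [e3] at e4
    refine e4.trans (mul_le_mul_of_nonneg_right (hB' g' hg') ?_)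
    exact Finset.sum_nonneg fun i _ => mul_self_nonneg _
  have hclosed : IsClosed Cs := by
    have : Cs = {M | Mᵀ = M} ∩ ⋂ g ∈ G, ((⋂ u : Fin d → ℝ,
        {M | u ⬝ᵥ u ≤ B' * (u ⬝ᵥ ((g * M * gᵀ) *ᵥ u))}) ∩ {M | fro (g * M * gᵀ) ≤ R}) := by
      ext M; simp [Cs]
    rw [this]
    refine (isClosed_eq (by fun_prop) continuous_id).inter
      (isClosed_biInter fun g _ => (isClosed_iInter fun u => ?_).inter ?_)
    · exact isClosed_le continuous_const (continuous_const.mul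
        (Continuous.dotProduct continuous_const (Continuous.matrix_mulVec (by fun_prop)
          continuous_const)))
    · exact isClosed_le (fro_continuous.comp (by fun_prop)) continuous_const
  have hcomp : IsCompact Cs := by
    have hc : IsCompact (Set.pi Set.univ fun _ : Fin d => Set.pi Set.univ fun _ : Fin d =>
        Set.Icc (-(R + 1)) (R + 1)) :=
      isCompact_univ_pi fun _ => isCompact_univ_pi fun _ => isCompact_Icc
    refine hc.of_isClosed_subset hclosed ?_
    intro (M : Matrix (Fin d) (Fin d) ℝ) hM i _ j _
    have h2 := (hM.2 1 h1).2
    simp only [Matrix.one_mul, Matrix.transpose_one, Matrix.mul_one] at h2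
    have h3 : M i j ^ 2 ≤ fro M := by
      unfold fro
      refine le_trans ?_ (Finset.single_le_sum (f := fun i => ∑ j, M i j ^ 2)
        (fun i _ => by positivity) (Finset.mem_univ i))
      exact Finset.single_le_sum (f := fun j => M i j ^ 2)
        (fun i _ => by positivity) (Finset.mem_univ j)
    constructor <;> nlinarith [sq_nonneg (M i j - 1), sq_nonneg (M i j + 1)]
  let q : Matrix (Fin d) (Fin d) ℝ → ℝ := fun N => sSup ((fun g => fro (g * N * gᵀ)) '' G)
  have hq : Continuous q := by
    refine hG.continuous_sSup (f := fun N g => fro (g * N * gᵀ)) ?_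
    refine fro_continuous.comp (f := fun p : Matrix (Fin d) (Fin d) ℝ × Matrix (Fin d) (Fin d) ℝ
      => p.2 * p.1 * p.2ᵀ) (by fun_prop)
  have hqle : ∀ N, ∀ g ∈ G, fro (g * N * gᵀ) ≤ q N := fun N g hg =>
    le_csSup (hG.bddAbove_image (fro_continuous.comp (by fun_prop)).continuousOn) ⟨g, hg, rfl⟩
  obtain ⟨N, hN, hmin⟩ := hcomp.exists_isMinOn ⟨1, hone⟩ hq.continuousOn
  refine ⟨N, ?_, ?_⟩
  · refine Matrix.PosDef.of_dotProduct_mulVec_pos ?_ ?_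
    · rw [Matrix.IsHermitian, Matrix.conjTranspose_eq_transpose_of_trivial]; exact hN.1
    · intro u hu
      have h2 := (hN.2 1 h1).1 u
      simp only [Matrix.one_mul, Matrix.transpose_one, Matrix.mul_one] at h2
      have h3 : 0 < u ⬝ᵥ u := by
        refine lt_of_le_of_ne (Finset.sum_nonneg fun i _ => mul_self_nonneg _) fun h => hu ?_
        exact dotProduct_self_eq_zero.1 h.symm
      rw [star_trivial]
      by_contra h4
      push Not at h4
      nlinarith
  · intro h hh
    set N' := h * N * hᵀ with hN'
    have hgN' : ∀ g, g * N' * gᵀ = (g * h) * N * (g * h)ᵀ := by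
      intro g; rw [hN', Matrix.transpose_mul]; simp only [Matrix.mul_assoc]
    have hmid : (1 / 2 : ℝ) • (N + N') ∈ Cs := by
      refine ⟨?_, fun g hg => ?_⟩
      · rw [Matrix.transpose_smul, Matrix.transpose_add, hN.1, hN']
        simp only [Matrix.transpose_mul, Matrix.transpose_transpose, hN.1, Matrix.mul_assoc]
      · have e : g * ((1 / 2 : ℝ) • (N + N')) * gᵀ =
            (1 / 2 : ℝ) • (g * N * gᵀ + (g * h) * N * (g * h)ᵀ) := by
          rw [← hgN']
          simp only [Matrix.mul_smul, Matrix.smul_mul, Matrix.mul_add, Matrix.add_mul]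
        obtain ⟨a1, a2⟩ := hN.2 g hg
        obtain ⟨b1, b2⟩ := hN.2 (g * h) (hmul g hg h hh)
        rw [e]
        refine ⟨fun u => ?_, ?_⟩
        · rw [Matrix.smul_mulVec, Matrix.add_mulVec, dotProduct_smul, dotProduct_add, smul_eq_mul]
          have := a1 u
          have := b1 u
          nlinarith
        · rw [fro_par]
          have := fro_nonneg (g * N * gᵀ - (g * h) * N * (g * h)ᵀ)
          linarith
    obtain ⟨g, hg, hge⟩ := hG.exists_sSup_image_eq ⟨1, h1⟩
      (f := fun g => fro (g * ((1 / 2 : ℝ) • (N + N')) * gᵀ))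
      (fro_continuous.comp (by fun_prop)).continuousOn
    have hle : q N ≤ q ((1 / 2 : ℝ) • (N + N')) := hmin hmid
    have hge' : q ((1 / 2 : ℝ) • (N + N')) = fro (g * ((1 / 2 : ℝ) • (N + N')) * gᵀ) := hge
    have e : g * ((1 / 2 : ℝ) • (N + N')) * gᵀ = (1 / 2 : ℝ) • (g * N * gᵀ + g * N' * gᵀ) := by
      simp only [Matrix.mul_smul, Matrix.smul_mul, Matrix.mul_add, Matrix.add_mul]
    rw [hge', e, fro_par] at hle
    have l1 := hqle N g hg
    have l2 := hqle N (g * h) (hmul g hg h hh)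
    rw [← hgN'] at l2
    have l3 : g * N * gᵀ - g * N' * gᵀ = 0 := fro_eq_zero (by linarith)
    obtain ⟨g', -, e1, e2⟩ := hinv g hg
    have e3 : gᵀ * g'ᵀ = 1 := by rw [← Matrix.transpose_mul, e1, Matrix.transpose_one]
    have l4 : g' * (g * N * gᵀ) * g'ᵀ = g' * (g * N' * gᵀ) * g'ᵀ := by rw [sub_eq_zero.1 l3]
    have l5 : ∀ M, g' * (g * M * gᵀ) * g'ᵀ = M := by
      intro M
      calc g' * (g * M * gᵀ) * g'ᵀ = (g' * g) * M * (gᵀ * g'ᵀ) := by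
            simp only [Matrix.mul_assoc]
        _ = M := by rw [e1, e3, Matrix.one_mul, Matrix.mul_one]
    rw [l5, l5] at l4
    exact l4.symm

end InvForm

section Final
open scoped Matrix.Norms.L2Operator MatrixOrder

variable {𝒜 : Type*} {d : ℕ} {H : 𝒜 → 𝒜 → Prop} {A : Seq 𝒜 → GL (Fin d) ℝ} {C ρ K : ℝ}

theorem exists_field (hT : IsTransitive H) (hH : Hol H A C ρ) (hB : Bdd H A K) :
    ∃ N : Seq 𝒜 → Matrix (Fin d) (Fin d) ℝ, (∀ x ∈ SFT H, (N x).PosDef) ∧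
      (∀ x ∈ SFT H, (A x).val * N x * (A x).valᵀ = N (shift x)) ∧
      ∀ (ys : ℕ → Seq 𝒜) (y : Seq 𝒜), (∀ k, ys k ∈ SFT H) → y ∈ SFT H → Conv ys y →
        ∃ φ : ℕ → ℕ, StrictMono φ ∧ Tendsto (fun k => N (ys (φ k))) atTop (𝓝 (N y)) := by
  obtain ⟨x0, hx0, -⟩ := trans_dense hT
  obtain ⟨g0, hg0⟩ := Rch_nonempty hT hB hx0 hx0
  obtain ⟨g1, hg1, e1, -⟩ := Rch_inv hT hH hB hx0 hx0 hg0
  obtain ⟨N0, hN0, hinv⟩ := exists_inv_form {g | Rch H A x0 x0 g} (Rch_compact hB x0 x0)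
    (by have := Rch_comp hH hB hg0 hg1; rw [e1] at this; exact this)
    (fun g hg h hh => Rch_comp hH hB hh hg) (fun g hg => Rch_inv hT hH hB hx0 hx0 hg)
  have hne : ∀ y, ∃ g, y ∈ SFT H → Rch H A x0 y g := by
    intro y
    by_cases hy : y ∈ SFT H
    · obtain ⟨g, hg⟩ := Rch_nonempty hT hB hx0 hy
      exact ⟨g, fun _ => hg⟩
    · exact ⟨1, fun h => absurd h hy⟩
  choose h hh using hne
  have hind : ∀ y ∈ SFT H, ∀ g, Rch H A x0 y g → g * N0 * gᵀ = h y * N0 * (h y)ᵀ := by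
    intro y hy g hg
    obtain ⟨g', hg', -, e2⟩ := Rch_inv hT hH hB hx0 hy (hh y hy)
    have e3 := hinv (g' * g) (Rch_comp hH hB hg hg')
    have e4 : h y * (g' * g) = g := by rw [← Matrix.mul_assoc, e2, Matrix.one_mul]
    calc g * N0 * gᵀ = (h y * (g' * g)) * N0 * (h y * (g' * g))ᵀ := by rw [e4]
      _ = h y * ((g' * g) * N0 * (g' * g)ᵀ) * (h y)ᵀ := by
        rw [Matrix.transpose_mul (h y)]
        simp only [Matrix.mul_assoc]
      _ = _ := by rw [e3]
  refine ⟨fun y => h y * N0 * (h y)ᵀ, ?_, ?_, ?_⟩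
  · intro y hy
    have hu : IsUnit (h y) := Rch_unit hB (hh y hy)
    have := hN0.mul_mul_conjTranspose_same (B := h y) (Matrix.vecMul_injective_iff_isUnit.2 hu)
    rwa [Matrix.conjTranspose_eq_transpose_of_trivial] at this
  · intro x hx
    have := hind (shift x) (shift_mem hx) _ (Rch_comp hH hB (hh x hx) (Rch_step hx))
    dsimp only
    rw [← this]
    simp only [Matrix.transpose_mul, Matrix.mul_assoc]
  · intro ys y hys hy hc
    have := proper_mat (d := d)
    have hb : ∀ k, h (ys k) ∈ Metric.closedBall (0 : Matrix (Fin d) (Fin d) ℝ) K := by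
      intro k
      rw [mem_closedBall_zero_iff]
      exact Rch_norm hB (hh _ (hys k))
    obtain ⟨g, -, φ, hφ, hg⟩ := (isCompact_closedBall (0 : Matrix (Fin d) (Fin d) ℝ) K).tendsto_subseq hb
    have hR : Rch H A x0 y g := Rch_closed (ys := fun k => ys (φ k)) (fun k => hh _ (hys (φ k)))
      (fun m => hφ.tendsto_atTop.eventually (hc m)) hg
    refine ⟨φ, hφ, ?_⟩
    dsimp only
    rw [← hind y hy g hR]
    have hcont : Continuous fun g : Matrix (Fin d) (Fin d) ℝ => g * N0 * gᵀ := by fun_prop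
    exact (hcont.tendsto g).comp hg

theorem conj_of_bdd (hT : IsTransitive H) (hH : Hol H A C ρ) (hB : Bdd H A K) :
    ConjIsometric H A := by
  obtain ⟨N, hpos, heq, hcont⟩ := exists_field hT hH hB
  have hPP : ∀ x ∈ SFT H, CFC.sqrt (N x) * CFC.sqrt (N x) = N x := fun x hx =>
    CFC.sqrt_mul_sqrt_self (N x) (Matrix.nonneg_iff_posSemidef.2 (hpos x hx).posSemidef)
  have hsym : ∀ x, (CFC.sqrt (N x))ᵀ = CFC.sqrt (N x) := by
    intro x
    have := (Matrix.nonneg_iff_posSemidef.1 (CFC.sqrt_nonneg (N x))).isHermitian.eq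
    rwa [Matrix.conjTranspose_eq_transpose_of_trivial] at this
  have hunit : ∀ x, ∃ u : GL (Fin d) ℝ, x ∈ SFT H → u.val = CFC.sqrt (N x) := by
    intro x
    by_cases hx : x ∈ SFT H
    · have hu : IsUnit (CFC.sqrt (N x)) := by
        have h1 := (hpos x hx).isUnit
        rw [← hPP x hx] at h1
        rw [Matrix.isUnit_iff_isUnit_det] at h1 ⊢
        rw [Matrix.det_mul] at h1
        exact isUnit_of_mul_isUnit_left h1
      exact ⟨hu.unit, fun _ => rfl⟩
    · exact ⟨1, fun h => absurd h hx⟩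
  choose P hP using hunit
  refine ⟨P, ?_, ?_⟩
  · intro x hx ε hε
    by_contra hcon
    push Not at hcon
    have := fun k : ℕ => hcon ((2 : ℝ) ^ (-(k : ℤ))) (by positivity)
    choose ys hys hd hn using this
    obtain ⟨φ, hφ, ht⟩ := hcont ys x hys hx
      (conv_of_agree fun k i hi => (agree_of_dist (hd k) i hi).symm)
    have hs : Tendsto (fun k => CFC.sqrt (N (ys (φ k)))) atTop (𝓝 (CFC.sqrt (N x))) := by
      have hw := CFC.continuousOn_sqrt (A := Matrix (Fin d) (Fin d) ℝ) (N x)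
        (Matrix.nonneg_iff_posSemidef.2 (hpos x hx).posSemidef)
      refine hw.tendsto.comp (tendsto_nhdsWithin_iff.2 ⟨ht, Eventually.of_forall fun k => ?_⟩)
      exact Matrix.nonneg_iff_posSemidef.2 (hpos _ (hys _)).posSemidef
    obtain ⟨k, hk⟩ := ((tendsto_iff_norm_sub_tendsto_zero.1 hs).eventually_lt_const hε).exists
    have h1 := hn (φ k)
    rw [opNorm_eq] at h1
    unfold glMat at h1
    rw [hP _ hx, hP _ (hys _), norm_sub_rev] at h1
    linarith
  · intro x hx
    have hx' := shift_mem hx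
    set Q := P (shift x) with hQ
    have hQv : Q.val = CFC.sqrt (N (shift x)) := hP _ hx'
    have hR : (P x).val * (P x).val = N x := by rw [hP x hx]; exact hPP x hx
    have hRs : (P x).valᵀ = (P x).val := by rw [hP x hx]; exact hsym x
    have hQs : Q.valᵀ = Q.val := by rw [hQv]; exact hsym _
    have hQQ : Q.val * Q.val = N (shift x) := by rw [hQv]; exact hPP _ hx'
    have hi1 : (Q⁻¹).val * Q.val = 1 := by rw [← Units.val_mul, inv_mul_cancel, Units.val_one]
    have hi2 : Q.val * (Q⁻¹).val = 1 := by rw [← Units.val_mul, mul_inv_cancel, Units.val_one]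
    have hi3 : Q.val * (Q⁻¹).valᵀ = 1 := by
      have := congrArg Matrix.transpose hi1
      rwa [Matrix.transpose_mul, hQs, Matrix.transpose_one] at this
    rw [Matrix.mem_orthogonalGroup_iff]
    unfold glMat
    rw [Units.val_mul, Units.val_mul]
    calc (Q⁻¹).val * (A x).val * (P x).val * ((Q⁻¹).val * (A x).val * (P x).val)ᵀ
        = (Q⁻¹).val * ((A x).val * ((P x).val * (P x).val) * (A x).valᵀ) * (Q⁻¹).valᵀ := by
          simp only [Matrix.transpose_mul, hRs, Matrix.mul_assoc]
      _ = (Q⁻¹).val * (Q.val * Q.val) * (Q⁻¹).valᵀ := by rw [hR, heq x hx, hQQ]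
      _ = ((Q⁻¹).val * Q.val) * (Q.val * (Q⁻¹).valᵀ) := by simp only [Matrix.mul_assoc]
      _ = 1 := by rw [hi1, hi3, Matrix.one_mul]

end Final

/-- Theorem on rigidity. If an `α`-Hölder `GL(d,ℝ)` cocycle over a
transitive SFT of positive entropy satisfies `h_top(σ|B(A,κ)) = h_top(σ|Σ_H)` for some
`κ > 0`, then it is continuously conjugate to an isometric cocycle. -/
theorem statement4 {𝒜 : Type*} [Fintype 𝒜] [DecidableEq 𝒜] {d : ℕ}
    (H : 𝒜 → 𝒜 → Prop) (α : ℝ) (hα : 0 < α)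
    (hTrans : IsTransitive H) (hEnt : 0 < entropy (SFT H))
    (A : Seq 𝒜 → GL (Fin d) ℝ) (hHol : IsHolder H A α)
    (κ : ℝ) (hκ : 0 < κ)
    (hfull : entropy (BSet H A κ) = entropy (SFT H)) :
    ConjIsometric H A := by
  obtain ⟨C, ρ, hH⟩ := hol_of_holder hα hHol
  exact conj_of_bdd hTrans hH (bdd_of_full hTrans hEnt hH hκ hfull)

end Paper
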